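/- arXiv:1002.1008 — 3 statements merged into one kernel-verified Lean document; each statement's English description precedes it below -/
import Mathlib

section
/- (Weyman) Let f ∈ V_d be a binary form of degree d and let k ≥ 1 with d > 4k − 4. If the transvectants (f,f)_{2j} vanish for all j with k ≤ j ≤ ⌊d/2⌋, then f has a root of multiplicity at least d − k + 1. -/
open MvPolynomial

/-- The `k`-th transvectant of two binary forms `f` of degree `n` and `g` of degree `m`. -/
noncomputable def transv (n m k : ℕ)
    (f g : MvPolynomial (Fin 2) ℂ) : MvPolynomial (Fin 2) ℂ :=
  ((((n - k).factorial * (m - k).factorial : ℕ) : ℂ) / ((n.factorial * m.factorial : ℕ) : ℂ)) •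
    ∑ i ∈ Finset.range (k + 1),
      ((-1 : ℂ) ^ i * (k.choose i : ℂ)) •
        ((fun p => pderiv (0 : Fin 2) p)^[k - i] ((fun p => pderiv (1 : Fin 2) p)^[i] f) *
         (fun p => pderiv (0 : Fin 2) p)^[i] ((fun p => pderiv (1 : Fin 2) p)^[k - i] g))

/-- A binary form `f` has a root of multiplicity (at least) `r` if some nonzero linear
form `ℓ = αx + βy` satisfies `ℓ^r ∣ f`. -/
def HasRootOfMult (r : ℕ) (f : MvPolynomial (Fin 2) ℂ) : Prop :=
  ∃ a b : ℂ, (a ≠ 0 ∨ b ≠ 0) ∧ (C a * X 0 + C b * X 1) ^ r ∣ f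

/-- The binary form `∑ binom(n, i) aᵢ x^(n-i) y^i` with normalized coefficients `a`. -/
noncomputable def binaryForm (n : ℕ) (a : ℕ → ℂ) : MvPolynomial (Fin 2) ℂ :=
  ∑ i ∈ Finset.range (n + 1), C ((n.choose i : ℂ) * a i) * (X 0 ^ (n - i) * X 1 ^ i)

theorem pderiv_zero_binaryForm (n : ℕ) (a : ℕ → ℂ) :
    pderiv (0 : Fin 2) (binaryForm (n + 1) a) = C ((n : ℂ) + 1) * binaryForm n a := by
  unfold binaryForm
  rw [map_sum, Finset.sum_range_succ, Finset.mul_sum]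
  have hlast : pderiv (0 : Fin 2) (C (((n + 1).choose (n + 1) : ℂ) * a (n + 1)) *
      (X 0 ^ (n + 1 - (n + 1)) * X 1 ^ (n + 1)) : MvPolynomial (Fin 2) ℂ) = 0 := by
    simp [Derivation.leibniz, pderiv_X, Derivation.leibniz_pow]
  rw [hlast, add_zero]
  refine Finset.sum_congr rfl fun i hi => ?_
  have hi : i ≤ n := by simpa [Nat.lt_succ_iff] using hi
  obtain ⟨j, rfl⟩ := Nat.exists_eq_add_of_le hi
  have h1 : i + j + 1 - i = j + 1 := by omega
  have h2 : i + j - i = j := by omega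
  have hc : ((i + j + 1).choose i : ℂ) * ((j : ℂ) + 1) =
      (((i + j : ℕ) : ℂ) + 1) * ((i + j).choose i : ℂ) := by
    have := Nat.choose_mul_succ_eq (i + j) i
    rw [h1] at this
    exact_mod_cast by linarith
  rw [h1, h2]
  simp only [Derivation.leibniz, pderiv_C, pderiv_X, Derivation.leibniz_pow, smul_eq_mul,
    Pi.single_apply, nsmul_eq_mul]
  have hc' := congrArg (C : ℂ → MvPolynomial (Fin 2) ℂ) hc
  simp only [map_mul, map_add, map_one, map_natCast, Nat.cast_add] at hc'
  simp
  linear_combination (C (a i) * X 0 ^ j * X 1 ^ i) * hc'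

theorem pderiv_one_binaryForm (n : ℕ) (a : ℕ → ℂ) :
    pderiv (1 : Fin 2) (binaryForm (n + 1) a) =
      C ((n : ℂ) + 1) * binaryForm n (fun i => a (i + 1)) := by
  unfold binaryForm
  rw [map_sum, Finset.sum_range_succ', Finset.mul_sum]
  have hfirst : pderiv (1 : Fin 2) (C (((n + 1).choose 0 : ℂ) * a 0) *
      (X 0 ^ (n + 1 - 0) * X 1 ^ 0) : MvPolynomial (Fin 2) ℂ) = 0 := by
    simp [Derivation.leibniz, pderiv_X, Derivation.leibniz_pow]
  rw [hfirst, add_zero]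
  refine Finset.sum_congr rfl fun i _ => ?_
  have h1 : n + 1 - (i + 1) = n - i := by omega
  have hc : ((n + 1).choose (i + 1) : ℂ) * ((i : ℂ) + 1) =
      ((n : ℂ) + 1) * (n.choose i : ℂ) := by
    exact_mod_cast (Nat.add_one_mul_choose_eq n i).symm
  rw [h1]
  simp only [Derivation.leibniz, pderiv_C, pderiv_X, Derivation.leibniz_pow, smul_eq_mul,
    Pi.single_apply, nsmul_eq_mul]
  have hc' := congrArg (C : ℂ → MvPolynomial (Fin 2) ℂ) hc
  simp only [map_mul, map_add, map_one, map_natCast] at hc'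
  simp
  linear_combination (C (a (i + 1)) * X 0 ^ (n - i) * X 1 ^ i) * hc'

theorem iterate_pderiv_C_mul (i : Fin 2) (p : ℕ) (c : ℂ) (g : MvPolynomial (Fin 2) ℂ) :
    (fun q => pderiv i q)^[p] (C c * g) = C c * (fun q => pderiv i q)^[p] g :=
  (Function.Semiconj.iterate_right (f := fun q => C c * q)
    (ga := fun q => pderiv i q) (gb := fun q => pderiv i q) (fun q => by simp) p g).symm

theorem iterate_pderiv_zero_binaryForm (p n : ℕ) (a : ℕ → ℂ) :
    (fun q => pderiv (0 : Fin 2) q)^[p] (binaryForm (n + p) a) =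
      C (((n + p).descFactorial p : ℕ) : ℂ) * binaryForm n a := by
  induction p with
  | zero => simp
  | succ p ih =>
    rw [Function.iterate_succ_apply, ← add_assoc, pderiv_zero_binaryForm]
    rw [iterate_pderiv_C_mul, ih, Nat.succ_descFactorial_succ, ← mul_assoc, ← C_mul]
    push_cast
    rfl

theorem iterate_pderiv_one_binaryForm (p n : ℕ) (a : ℕ → ℂ) :
    (fun q => pderiv (1 : Fin 2) q)^[p] (binaryForm (n + p) a) =
      C (((n + p).descFactorial p : ℕ) : ℂ) * binaryForm n (fun i => a (i + p)) := by
  induction p generalizing a with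
  | zero => simp
  | succ p ih =>
    rw [Function.iterate_succ_apply, ← add_assoc, pderiv_one_binaryForm]
    rw [iterate_pderiv_C_mul, ih, Nat.succ_descFactorial_succ, ← mul_assoc, ← C_mul]
    push_cast
    rfl

theorem iterate_pderiv_binaryForm (n p q : ℕ) (a : ℕ → ℂ) :
    (fun r => pderiv (0 : Fin 2) r)^[p]
        ((fun r => pderiv (1 : Fin 2) r)^[q] (binaryForm (n + (p + q)) a)) =
      C (((n + (p + q)).descFactorial (p + q) : ℕ) : ℂ) *
        binaryForm n (fun i => a (i + q)) := by
  rw [← add_assoc, iterate_pderiv_one_binaryForm, iterate_pderiv_C_mul,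
    iterate_pderiv_zero_binaryForm, ← mul_assoc, ← C_mul, add_comm p q,
    ← Nat.descFactorial_mul_descFactorial (Nat.le_add_right q p)]
  congr 2
  push_cast
  rw [Nat.add_sub_cancel, Nat.add_sub_cancel_left, mul_comm]

theorem eq_binaryForm_of_isHomogeneous {d : ℕ} {f : MvPolynomial (Fin 2) ℂ}
    (hf : f.IsHomogeneous d) : ∃ a : ℕ → ℂ, f = binaryForm d a := by
  refine ⟨fun i => coeff (Finsupp.single 0 (d - i) + Finsupp.single 1 i) f / (d.choose i : ℂ), ?_⟩
  have hmono : ∀ p q : ℕ, (X 0 ^ p * X 1 ^ q : MvPolynomial (Fin 2) ℂ) =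
      monomial (Finsupp.single 0 p + Finsupp.single 1 q) 1 := by
    intro p q
    rw [X_pow_eq_monomial, X_pow_eq_monomial, monomial_mul, one_mul]
  ext m
  unfold binaryForm
  simp only [hmono, coeff_sum, coeff_C_mul, coeff_monomial]
  by_cases hm : m 0 + m 1 = d
  · have hm' : Finsupp.single 0 (d - m 1) + Finsupp.single 1 (m 1) = m := by
      ext i
      fin_cases i
      · simp; omega
      · simp
    rw [Finset.sum_eq_single (m 1)]
    · have hne : (d.choose (m 1) : ℂ) ≠ 0 := by
        exact_mod_cast (Nat.choose_pos (by omega)).ne'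
      rw [hm', if_pos rfl]
      field_simp
    · intro b _ hb
      rw [if_neg, mul_zero]
      rintro rfl
      simp at hb
    · intro h
      exact absurd (Finset.mem_range.2 (by omega)) h
  · rw [Finset.sum_eq_zero]
    · by_contra h
      apply hm
      have := hf h
      simpa [Finsupp.weight_apply, Finsupp.sum_fintype] using this
    · intro i hi
      rw [if_neg, mul_zero]
      rintro rfl
      have := Finset.mem_range.1 hi
      apply hm
      simp
      omega

/-- The alternating sum `∑ (-1)^i binom(m, i) a_{s+i} a_{t+m-i}`. -/
def alternatingProduct (a : ℕ → ℂ) (m s t : ℕ) : ℂ :=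
  ∑ ij ∈ Finset.HasAntidiagonal.antidiagonal m,
    (m.choose ij.1 : ℂ) * ((-1) ^ ij.1 * (a (s + ij.1) * a (t + ij.2)))

theorem alternatingProduct_succ (a : ℕ → ℂ) (m s t : ℕ) :
    alternatingProduct a (m + 1) s t =
      alternatingProduct a m s (t + 1) - alternatingProduct a m (s + 1) t := by
  unfold alternatingProduct
  rw [Finset.sum_antidiagonal_choose_succ_mul
    (fun i j => (-1 : ℂ) ^ i * (a (s + i) * a (t + j))) m, sub_eq_add_neg, ← Finset.sum_neg_distrib]
  congr 1
  · refine Finset.sum_congr rfl fun ij _ => ?_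
    rw [add_assoc t, add_comm 1]
  · refine Finset.sum_congr rfl fun ij hij => ?_
    rw [← Finset.HasAntidiagonal.mem_antidiagonal.1 hij, Nat.choose_symm_add, add_assoc s,
      add_comm 1]
    ring

theorem alternatingProduct_swap (a : ℕ → ℂ) (m s t : ℕ) :
    alternatingProduct a m t s = (-1) ^ m * alternatingProduct a m s t := by
  unfold alternatingProduct
  rw [← Finset.Nat.sum_antidiagonal_swap, Finset.mul_sum]
  refine Finset.sum_congr rfl fun ij hij => ?_
  rw [← Finset.HasAntidiagonal.mem_antidiagonal.1 hij]
  simp only [Prod.fst_swap, Prod.snd_swap]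
  rw [← Nat.choose_symm_add, pow_add]
  have h : ((-1 : ℂ) ^ ij.1) * (-1) ^ ij.1 = 1 := by
    rw [← mul_pow]; simp
  linear_combination (-((ij.1 + ij.2).choose ij.1 : ℂ) * (-1) ^ ij.2 *
    (a (s + ij.1) * a (t + ij.2))) * h

/-- Dehomogenization of a binary form. -/
noncomputable def dehom : MvPolynomial (Fin 2) ℂ →ₐ[ℂ] Polynomial ℂ :=
  aeval ![1, Polynomial.X]

theorem coeff_dehom_binaryForm (n : ℕ) (a : ℕ → ℂ) (u : ℕ) :
    (dehom (binaryForm n a)).coeff u = (n.choose u : ℂ) * a u := by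
  unfold dehom binaryForm
  simp only [map_sum, map_mul, map_pow, aeval_X, Matrix.cons_val_zero, Matrix.cons_val_one,
    one_pow, one_mul, ← algebraMap_eq, AlgHom.commutes]
  simp only [Polynomial.algebraMap_eq, ← map_mul, Polynomial.finsetSum_coeff,
    Polynomial.coeff_C_mul_X_pow]
  rw [Finset.sum_ite_eq]
  split_ifs with h
  · rfl
  · rw [Nat.choose_eq_zero_of_lt (by simpa using h)]
    simp

theorem sum_choose_mul_alternatingProduct_eq_zero {n m : ℕ} {a : ℕ → ℂ}
    (h : transv (n + m) (n + m) m (binaryForm (n + m) a) (binaryForm (n + m) a) = 0) (u : ℕ) :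
    ∑ st ∈ Finset.HasAntidiagonal.antidiagonal u,
      (n.choose st.1 : ℂ) * (n.choose st.2 : ℂ) * alternatingProduct a m st.1 st.2 = 0 := by
  unfold transv at h
  rw [smul_eq_zero] at h
  replace h := h.resolve_left (by
    refine div_ne_zero ?_ ?_ <;>
      exact_mod_cast (Nat.mul_pos (Nat.factorial_pos _) (Nat.factorial_pos _)).ne')
  have hterm : ∀ i ∈ Finset.range (m + 1),
      ((-1 : ℂ) ^ i * (m.choose i : ℂ)) •
        ((fun p => pderiv (0 : Fin 2) p)^[m - i]
            ((fun p => pderiv (1 : Fin 2) p)^[i] (binaryForm (n + m) a)) *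
         (fun p => pderiv (0 : Fin 2) p)^[i]
            ((fun p => pderiv (1 : Fin 2) p)^[m - i] (binaryForm (n + m) a))) =
      (((n + m).descFactorial m : ℂ) ^ 2) • (((-1 : ℂ) ^ i * (m.choose i : ℂ)) •
        (binaryForm n (fun j => a (j + i)) * binaryForm n (fun j => a (j + (m - i))))) := by
    intro i hi
    have hi : i ≤ m := by simpa [Nat.lt_succ_iff] using hi
    have h1 := iterate_pderiv_binaryForm n (m - i) i a
    have h2 := iterate_pderiv_binaryForm n i (m - i) a
    rw [Nat.sub_add_cancel hi] at h1
    rw [Nat.add_sub_cancel' hi] at h2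
    rw [h1, h2]
    simp only [smul_eq_C_mul, map_mul, map_pow]
    ring
  rw [Finset.sum_congr rfl hterm, ← Finset.smul_sum, smul_eq_zero] at h
  replace h := h.resolve_left (by
    refine pow_ne_zero 2 ?_
    exact_mod_cast (Nat.descFactorial_pos.2 (Nat.le_add_left m n)).ne')
  have hc := congrArg (fun q => (dehom q).coeff u) h
  simp only [map_sum, map_smul, map_mul, Polynomial.finsetSum_coeff, Polynomial.coeff_smul,
    Polynomial.coeff_mul, coeff_dehom_binaryForm, map_zero, Polynomial.coeff_zero,
    smul_eq_mul] at hc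
  rw [← hc]
  unfold alternatingProduct
  simp only [Finset.mul_sum]
  rw [Finset.sum_comm, Finset.Nat.sum_antidiagonal_eq_sum_range_succ_mk]
  refine Finset.sum_congr rfl fun i _ => Finset.sum_congr rfl fun st _ => ?_
  ring

theorem alternatingProduct_eq_zero {d k : ℕ} (hk : 1 ≤ k) {a : ℕ → ℂ}
    (hvan : ∀ j : ℕ, k ≤ j → j ≤ d / 2 →
      transv d d (2 * j) (binaryForm d a) (binaryForm d a) = 0)
    (m s t : ℕ) (hm : 2 * k - 1 ≤ m) (hs : s + m ≤ d) (ht : t + m ≤ d) :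
    alternatingProduct a m s t = 0 := by
  obtain ⟨c, hc⟩ : ∃ c, d + 1 - m = c := ⟨_, rfl⟩
  induction c generalizing m s t with
  | zero => omega
  | succ c ih =>
    have hstep : ∀ s t, s + (m + 1) ≤ d → t + (m + 1) ≤ d →
        alternatingProduct a m s (t + 1) = alternatingProduct a m (s + 1) t := by
      intro s t hs ht
      have := ih (m + 1) s t (by omega) hs ht (by omega)
      rwa [alternatingProduct_succ, sub_eq_zero] at this
    have hshift : ∀ j s t, s + j + m ≤ d → t + j + m ≤ d →
        alternatingProduct a m s (t + j) = alternatingProduct a m (s + j) t := by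
      intro j
      induction j with
      | zero => intros; rfl
      | succ j ihj =>
        intro s t hs ht
        rw [← add_assoc, hstep s (t + j) (by omega) (by omega), ihj (s + 1) t (by omega) (by omega)]
        congr 1
        omega
    have hdiag : ∀ s t s' t', s + t = s' + t' → s + m ≤ d → t + m ≤ d → s' + m ≤ d →
        t' + m ≤ d → alternatingProduct a m s t = alternatingProduct a m s' t' := by
      intro s t s' t' h hs ht hs' ht'
      rcases le_total s s' with hss | hss
      · obtain ⟨j, rfl⟩ := Nat.exists_eq_add_of_le hss
        obtain rfl : t = t' + j := by omega
        exact hshift j s t' (by omega) (by omega)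
      · obtain ⟨j, rfl⟩ := Nat.exists_eq_add_of_le hss
        obtain rfl : t' = t + j := by omega
        exact (hshift j s' t (by omega) (by omega)).symm
    rcases Nat.even_or_odd' m with ⟨j, rfl | rfl⟩
    · obtain ⟨n, rfl⟩ : ∃ n, d = n + 2 * j := ⟨d - 2 * j, by omega⟩
      have hsum := sum_choose_mul_alternatingProduct_eq_zero
        (hvan j (by omega) (by omega)) (s + t)
      have hconst : ∀ st ∈ Finset.HasAntidiagonal.antidiagonal (s + t),
          (n.choose st.1 : ℂ) * (n.choose st.2 : ℂ) * alternatingProduct a (2 * j) st.1 st.2 =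
            (n.choose st.1 : ℂ) * (n.choose st.2 : ℂ) * alternatingProduct a (2 * j) s t := by
        intro st hst
        rw [Finset.HasAntidiagonal.mem_antidiagonal] at hst
        by_cases h1 : st.1 ≤ n
        · by_cases h2 : st.2 ≤ n
          · rw [hdiag st.1 st.2 s t hst (by omega) (by omega) hs ht]
          · simp [Nat.choose_eq_zero_of_lt (not_le.1 h2)]
        · simp [Nat.choose_eq_zero_of_lt (not_le.1 h1)]
      rw [Finset.sum_congr rfl hconst, ← Finset.sum_mul] at hsum
      refine (mul_eq_zero.1 hsum).resolve_left ?_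
      have hv := Nat.add_choose_eq n n (s + t)
      have hpos : 0 < (n + n).choose (s + t) := Nat.choose_pos (by omega)
      rw [hv] at hpos
      exact_mod_cast hpos.ne'
    · have h1 := hdiag s t t s (add_comm _ _) hs ht ht hs
      have h2 := alternatingProduct_swap a (2 * j + 1) s t
      rw [pow_succ, pow_mul] at h2
      simp only [even_two, Even.neg_pow, one_pow, one_mul, neg_mul] at h2
      rw [h2] at h1
      exact self_eq_neg.1 h1

/-- The linear functional on polynomials sending `X ^ i` to `a i`. -/
noncomputable def momentFunctional {R : Type*} [CommRing R] (a : ℕ → R) :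
    Polynomial R →ₗ[R] R :=
  Polynomial.lsum fun i => a i • LinearMap.id

theorem momentFunctional_eq_sum {R : Type*} [CommRing R] (a : ℕ → R) {n : ℕ} {p : Polynomial R}
    (hp : p.natDegree ≤ n) :
    momentFunctional a p = ∑ i ∈ Finset.range (n + 1), p.coeff i * a i := by
  unfold momentFunctional
  rw [Polynomial.lsum_apply, Polynomial.sum_over_range' _ (by simp) (n + 1) (by omega)]
  simp [mul_comm]

theorem momentFunctional_X_pow {R : Type*} [CommRing R] (a : ℕ → R) (i : ℕ) :
    momentFunctional a (Polynomial.X ^ i) = a i := by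
  simp [momentFunctional, ← Polynomial.monomial_one_right_eq_X_pow]

theorem momentFunctional_mul_eq_sum {R : Type*} [CommRing R] (a : ℕ → R) (p : Polynomial R)
    {n : ℕ} {q : Polynomial R} (hq : q.natDegree ≤ n) :
    momentFunctional a (p * q) =
      ∑ i ∈ Finset.range (n + 1), q.coeff i * momentFunctional a (p * Polynomial.X ^ i) := by
  conv_lhs => rw [Polynomial.as_sum_range_C_mul_X_pow' (p := q) (Nat.lt_succ_of_le hq),
    Finset.mul_sum]
  rw [map_sum]
  refine Finset.sum_congr rfl fun i _ => ?_
  rw [mul_left_comm, ← Polynomial.smul_eq_C_mul, map_smul, smul_eq_mul]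

/-- The polynomials of formal degree `m` apolar to the binary form of degree `d` with normalized
coefficients `a`. -/
structure IsApolar (a : ℕ → ℂ) (d m : ℕ) (h : Polynomial ℂ) : Prop where
  natDegree_le : h.natDegree ≤ m
  vanish : ∀ s, s + m ≤ d → momentFunctional a (h * Polynomial.X ^ s) = 0

namespace IsApolar

variable {a : ℕ → ℂ} {d m n e : ℕ} {g h u : Polynomial ℂ}

theorem mono (hh : IsApolar a d m h) (hmn : m ≤ n) : IsApolar a d n h :=
  ⟨hh.natDegree_le.trans hmn, fun s hs => hh.vanish s (by omega)⟩

theorem momentFunctional_mul (hh : IsApolar a d m h) (hu : u.natDegree + m ≤ d) :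
    momentFunctional a (h * u) = 0 := by
  rw [momentFunctional_mul_eq_sum a h le_rfl]
  refine Finset.sum_eq_zero fun i hi => ?_
  have := Finset.mem_range.1 hi
  rw [hh.vanish i (by omega), mul_zero]

theorem sub_C_mul (hh : IsApolar a d m h) (hg : IsApolar a d m g) (c : ℂ) :
    IsApolar a d m (h - Polynomial.C c * g) := by
  refine ⟨(Polynomial.natDegree_sub_le _ _).trans (max_le hh.natDegree_le
    ((Polynomial.natDegree_C_mul_le _ _).trans hg.natDegree_le)), fun s hs => ?_⟩
  rw [sub_mul, map_sub, hh.vanish s hs, mul_assoc, ← Polynomial.smul_eq_C_mul, map_smul,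
    hg.vanish s hs]
  simp

/-- A linear factor not vanishing where `g` does not can be cancelled. -/
theorem of_X_sub_C_mul {p : ℂ} (hg : IsApolar a d e g) (hp : g.eval p ≠ 0) (hme : m + e ≤ d)
    (hh : IsApolar a d (m + 1) ((Polynomial.X - Polynomial.C p) * h)) : IsApolar a d m h := by
  have hdeg : h.natDegree ≤ m := by
    rcases eq_or_ne h 0 with rfl | h0
    · simp
    · have := hh.natDegree_le
      rw [Polynomial.natDegree_mul (Polynomial.X_sub_C_ne_zero p) h0,
        Polynomial.natDegree_X_sub_C] at this
      omega
  have hstep : ∀ s, s + (m + 1) ≤ d →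
      momentFunctional a (h * Polynomial.X ^ (s + 1)) =
        p * momentFunctional a (h * Polynomial.X ^ s) := by
    intro s hs
    have := hh.vanish s hs
    have heq : (Polynomial.X - Polynomial.C p) * h * Polynomial.X ^ s =
        h * Polynomial.X ^ (s + 1) - p • (h * Polynomial.X ^ s) := by
      rw [Polynomial.smul_eq_C_mul]; ring
    rwa [heq, map_sub, map_smul, smul_eq_mul, sub_eq_zero] at this
  have hpow : ∀ s, s + m ≤ d → momentFunctional a (h * Polynomial.X ^ s) =
      p ^ s * momentFunctional a h := by
    intro s
    induction s with
    | zero => simp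
    | succ s ih =>
      intro hs
      rw [hstep s (by omega), ih (by omega), pow_succ']
      ring
  have hzero : momentFunctional a h = 0 := by
    have h1 : momentFunctional a (h * g) = 0 := by
      rw [mul_comm]
      exact hg.momentFunctional_mul (by omega)
    rw [momentFunctional_mul_eq_sum a h hg.natDegree_le] at h1
    have h2 : ∑ i ∈ Finset.range (e + 1), g.coeff i * momentFunctional a (h * Polynomial.X ^ i) =
        g.eval p * momentFunctional a h := by
      rw [Polynomial.eval_eq_sum_range' (Nat.lt_succ_of_le hg.natDegree_le), Finset.sum_mul]
      refine Finset.sum_congr rfl fun i hi => ?_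
      have := Finset.mem_range.1 hi
      rw [hpow i (by omega), mul_assoc]
    rw [h2] at h1
    exact (mul_eq_zero.1 h1).resolve_left hp
  exact ⟨hdeg, fun s hs => by rw [hpow s hs, hzero, mul_zero]⟩

/-- An apolar polynomial `g` of minimal formal degree `e` divides all apolar polynomials of small
formal degree. -/
theorem exists_eq_mul (hg : IsApolar a d e g) (hg0 : g ≠ 0)
    (hmin : ∀ m < e, ∀ h, IsApolar a d m h → h = 0) (he : 1 ≤ e)
    (hh : IsApolar a d m h) (hm : m + e ≤ d + 1) :
    ∃ u : Polynomial ℂ, h = g * u ∧ (u = 0 ∨ u.natDegree + e ≤ m) := by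
  induction m generalizing h with
  | zero => exact ⟨0, by rw [hmin 0 he h hh, mul_zero], Or.inl rfl⟩
  | succ m ih =>
    rcases lt_or_ge (m + 1) e with hlt | hle
    · exact ⟨0, by rw [hmin _ hlt h hh, mul_zero], Or.inl rfl⟩
    obtain ⟨p, hp⟩ : ∃ p, g.eval p ≠ 0 := by
      by_contra! hcon
      exact hg0 (Polynomial.funext fun x => by simp [hcon x])
    have hsub := hh.sub_C_mul (hg.mono hle) (h.eval p / g.eval p)
    obtain ⟨h1, hh1⟩ : Polynomial.X - Polynomial.C p ∣
        h - Polynomial.C (h.eval p / g.eval p) * g := by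
      rw [Polynomial.dvd_iff_isRoot, Polynomial.IsRoot.def]
      simp [hp]
    rw [hh1] at hsub
    obtain ⟨u, hu, hdeg⟩ := ih (hg.of_X_sub_C_mul hp (by omega) hsub) (by omega)
    refine ⟨Polynomial.C (h.eval p / g.eval p) + (Polynomial.X - Polynomial.C p) * u, ?_, ?_⟩
    · rw [hu] at hh1
      linear_combination hh1
    · right
      rcases hdeg with rfl | hdeg
      · simpa using hle
      · have h2 : ((Polynomial.X - Polynomial.C p) * u).natDegree ≤ 1 + u.natDegree :=
          Polynomial.natDegree_mul_le.trans (by rw [Polynomial.natDegree_X_sub_C])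
        have h3 := Polynomial.natDegree_add_le (Polynomial.C (h.eval p / g.eval p))
          ((Polynomial.X - Polynomial.C p) * u)
        rw [Polynomial.natDegree_C, Nat.zero_max] at h3
        omega

end IsApolar

/-- The polynomial dual to `φ` under the invariant bilinear form on binary forms of degree `N`. -/
noncomputable def dualPolynomial (N : ℕ) (φ : ℕ → ℂ) : Polynomial ℂ :=
  ∑ ij ∈ Finset.HasAntidiagonal.antidiagonal N,
    Polynomial.C ((N.choose ij.1 : ℂ) * (-1) ^ ij.1 * φ ij.1) * Polynomial.X ^ ij.2

theorem natDegree_dualPolynomial_le (N : ℕ) (φ : ℕ → ℂ) :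
    (dualPolynomial N φ).natDegree ≤ N := by
  refine Polynomial.natDegree_sum_le_of_forall_le _ _ fun ij hij => ?_
  rw [Finset.HasAntidiagonal.mem_antidiagonal] at hij
  exact (Polynomial.natDegree_C_mul_X_pow_le _ _).trans (by omega)

theorem coeff_dualPolynomial (N : ℕ) (φ : ℕ → ℂ) {i : ℕ} (hi : i ≤ N) :
    (dualPolynomial N φ).coeff (N - i) = (N.choose i : ℂ) * (-1) ^ i * φ i := by
  unfold dualPolynomial
  simp only [Polynomial.finsetSum_coeff, Polynomial.coeff_C_mul_X_pow]
  rw [Finset.sum_eq_single (i, N - i)]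
  · simp
  · rintro ⟨p, q⟩ hpq hne
    rw [Finset.HasAntidiagonal.mem_antidiagonal] at hpq
    rw [if_neg]
    rintro rfl
    apply hne
    simp only at hpq ⊢
    congr 1
    omega
  · intro h
    exact absurd (by rw [Finset.HasAntidiagonal.mem_antidiagonal]; simp; omega) h

theorem momentFunctional_dualPolynomial_mul (N s : ℕ) (φ a : ℕ → ℂ) :
    momentFunctional a (dualPolynomial N φ * Polynomial.X ^ s) =
      ∑ ij ∈ Finset.HasAntidiagonal.antidiagonal N,
        (N.choose ij.1 : ℂ) * (-1) ^ ij.1 * φ ij.1 * a (s + ij.2) := by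
  unfold dualPolynomial
  rw [Finset.sum_mul, map_sum]
  refine Finset.sum_congr rfl fun ij _ => ?_
  rw [mul_assoc, ← pow_add, ← Polynomial.smul_eq_C_mul, map_smul, momentFunctional_X_pow,
    smul_eq_mul, add_comm s]

/-- If all shifts of `a` span an isotropic subspace, then every functional vanishing on the apolar
polynomials is dual to an apolar polynomial. -/
theorem isApolar_dualPolynomial {a φ : ℕ → ℂ} {d N : ℕ}
    (hiso : ∀ s t, s + N ≤ d → t + N ≤ d → alternatingProduct a N s t = 0)
    (hφ : ∀ h, IsApolar a d N h → ∑ i ∈ Finset.range (N + 1), h.coeff i * φ i = 0) :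
    IsApolar a d N (dualPolynomial N φ) := by
  refine ⟨natDegree_dualPolynomial_le N φ, fun t ht => ?_⟩
  let U : Submodule ℂ (Fin (N + 1) → ℂ) :=
    Submodule.span ℂ {v | ∃ s, s + N ≤ d ∧ v = fun i : Fin (N + 1) => a (s + i)}
  have hmem : (fun i : Fin (N + 1) => φ i) ∈ U := by
    by_contra hnot
    obtain ⟨ψ, hψ, hU⟩ := Submodule.exists_le_ker_of_notMem hnot
    have hψsum : ∀ v : ℕ → ℂ, ψ (fun i : Fin (N + 1) => v i) =
        ∑ i : Fin (N + 1), ψ (Pi.single i 1) * v i := by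
      intro v
      conv_lhs => rw [← LinearMap.sum_single_apply (fun i : Fin (N + 1) => ℂ)
        (fun i : Fin (N + 1) => v i)]
      rw [map_sum]
      refine Finset.sum_congr rfl fun i _ => ?_
      have : (Pi.single i (v i) : Fin (N + 1) → ℂ) = v i • Pi.single i (1 : ℂ) := by
        rw [← Pi.single_smul, smul_eq_mul, mul_one]
      rw [this, map_smul, smul_eq_mul, mul_comm]
    let c : ℕ → ℂ := fun i => if hi : i < N + 1 then ψ (Pi.single ⟨i, hi⟩ 1) else 0
    let h : Polynomial ℂ := ∑ i ∈ Finset.range (N + 1), Polynomial.C (c i) * Polynomial.X ^ i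
    have hcoeff : ∀ i ∈ Finset.range (N + 1), h.coeff i = c i := by
      intro i hi
      simp only [h, Polynomial.finsetSum_coeff, Polynomial.coeff_C_mul_X_pow]
      rw [Finset.sum_ite_eq, if_pos hi]
    have hsum : ∀ v : ℕ → ℂ, ∑ i ∈ Finset.range (N + 1), h.coeff i * v i =
        ψ (fun i : Fin (N + 1) => v i) := by
      intro v
      rw [hψsum, Finset.sum_congr rfl (fun i hi => by rw [hcoeff i hi]),
        Finset.sum_range]
      refine Finset.sum_congr rfl fun i _ => ?_
      simp only [c, i.isLt, dif_pos, Fin.eta]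
    have hdeg : h.natDegree ≤ N := by
      refine Polynomial.natDegree_sum_le_of_forall_le _ _ fun i hi => ?_
      have := Finset.mem_range.1 hi
      exact (Polynomial.natDegree_C_mul_X_pow_le _ _).trans (by omega)
    apply hψ
    rw [← hsum]
    refine hφ h ⟨hdeg, fun s hs => ?_⟩
    rw [mul_comm, momentFunctional_mul_eq_sum a _ hdeg]
    simp only [← pow_add, momentFunctional_X_pow]
    rw [hsum fun i => a (s + i)]
    exact hU (Submodule.subset_span ⟨s, hs, rfl⟩)
  have hlin : ∀ v ∈ U, ∀ w : ℕ → ℂ, (v = fun i : Fin (N + 1) => w i) →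
      momentFunctional a (dualPolynomial N w * Polynomial.X ^ t) = 0 := by
    let T : (Fin (N + 1) → ℂ) →ₗ[ℂ] ℂ := ∑ i : Fin (N + 1),
      ((N.choose i : ℂ) * (-1) ^ (i : ℕ) * a (t + (N - i))) • LinearMap.proj i
    have hT : ∀ w : ℕ → ℂ, T (fun i : Fin (N + 1) => w i) =
        momentFunctional a (dualPolynomial N w * Polynomial.X ^ t) := by
      intro w
      rw [momentFunctional_dualPolynomial_mul,
        Finset.Nat.sum_antidiagonal_eq_sum_range_succ_mk, Finset.sum_range]
      simp only [T, LinearMap.sum_apply, LinearMap.smul_apply, LinearMap.proj_apply, smul_eq_mul]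
      exact Finset.sum_congr rfl fun i _ => by ring
    have hker : U ≤ LinearMap.ker T := by
      refine Submodule.span_le.2 ?_
      rintro v ⟨s, hs, rfl⟩
      rw [SetLike.mem_coe, LinearMap.mem_ker, hT fun i => a (s + i),
        momentFunctional_dualPolynomial_mul, ← hiso s t hs ht]
      unfold alternatingProduct
      exact Finset.sum_congr rfl fun ij _ => by ring
    rintro v hv w rfl
    rw [← hT]
    exact hker hv
  exact hlin _ hmem φ rfl

theorem IsApolar.mul {a : ℕ → ℂ} {d m n : ℕ} {h u : Polynomial ℂ} (hh : IsApolar a d m h)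
    (hu : u.natDegree + m ≤ n) : IsApolar a d n (h * u) := by
  refine ⟨Polynomial.natDegree_mul_le.trans (by have := hh.natDegree_le; omega), fun s hs => ?_⟩
  rw [mul_assoc]
  refine hh.momentFunctional_mul ?_
  have h1 := Polynomial.natDegree_mul_le (p := u) (q := Polynomial.X ^ s)
  rw [Polynomial.natDegree_X_pow] at h1
  omega

theorem dualPolynomial_pow (N : ℕ) (μ : ℂ) :
    dualPolynomial N (fun i => μ ^ i) = (Polynomial.X - Polynomial.C μ) ^ N := by
  rw [sub_eq_neg_add, (Commute.all _ _).add_pow']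
  unfold dualPolynomial
  refine Finset.sum_congr rfl fun ij _ => ?_
  rw [neg_pow]
  simp only [map_mul, map_pow, map_neg, map_one, map_natCast, nsmul_eq_mul]
  ring

theorem natDegree_dualPolynomial_le_sub {N r : ℕ} {φ : ℕ → ℂ} (hφ : ∀ i < r, φ i = 0) :
    (dualPolynomial N φ).natDegree ≤ N - r := by
  refine Polynomial.natDegree_sum_le_of_forall_le _ _ fun ij hij => ?_
  rw [Finset.HasAntidiagonal.mem_antidiagonal] at hij
  rcases lt_or_ge ij.1 r with hlt | hge
  · simp [hφ _ hlt]
  · exact (Polynomial.natDegree_C_mul_X_pow_le _ _).trans (by omega)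

theorem dualPolynomial_ne_zero {N i : ℕ} {φ : ℕ → ℂ} (hi : i ≤ N) (hφ : φ i ≠ 0) :
    dualPolynomial N φ ≠ 0 := by
  intro h
  have := coeff_dualPolynomial N φ hi
  rw [h, Polynomial.coeff_zero] at this
  have hc : (N.choose i : ℂ) ≠ 0 := by exact_mod_cast (Nat.choose_pos hi).ne'
  exact mul_ne_zero (mul_ne_zero hc (pow_ne_zero i (by norm_num))) hφ this.symm

theorem sum_coeff_mul_choose_eq_zero {h : Polynomial ℂ} {N e r : ℕ} {μ : ℂ}
    (hN : h.natDegree ≤ N) (hr : r < e) (hdvd : (Polynomial.X - Polynomial.C μ) ^ e ∣ h) :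
    ∑ i ∈ Finset.range (N + 1), h.coeff i * ((i.choose r : ℂ) * μ ^ (i - r)) = 0 := by
  have h1 : (Polynomial.taylor μ h).coeff r = 0 := by
    obtain ⟨u, rfl⟩ := hdvd
    rw [Polynomial.taylor_mul, Polynomial.taylor_pow, map_sub, Polynomial.taylor_X,
      Polynomial.taylor_C, add_sub_cancel_right, Polynomial.coeff_X_pow_mul', if_neg (by omega)]
  rw [Polynomial.taylor_coeff, Polynomial.hasseDeriv_apply,
    Polynomial.sum_over_range' _ (by simp) (N + 1) (by omega), Polynomial.eval_finsetSum] at h1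
  rw [← h1]
  refine Finset.sum_congr rfl fun i _ => ?_
  rw [Polynomial.eval_monomial]
  ring

theorem exists_isApolar_pow {a : ℕ → ℂ} {d k : ℕ} (hk : 1 ≤ k) (hd : 4 * k - 4 < d)
    (hiso : ∀ s t, s + (2 * k - 1) ≤ d → t + (2 * k - 1) ≤ d →
      alternatingProduct a (2 * k - 1) s t = 0)
    (ha : ∃ i ≤ d, a i ≠ 0) :
    ∃ e ≤ k, (∃ μ, IsApolar a d e ((Polynomial.X - Polynomial.C μ) ^ e)) ∨ IsApolar a d e 1 := by
  classical
  obtain ⟨N, hN⟩ : ∃ N, 2 * k - 1 = N := ⟨_, rfl⟩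
  rw [hN] at hiso
  have hexN : ∃ h, h ≠ 0 ∧ IsApolar a d N h := by
    obtain ⟨i, hid, hi⟩ := ha
    obtain ⟨s, j, hs, hj, rfl⟩ : ∃ s j, s + N ≤ d ∧ j ≤ N ∧ s + j = i := by
      rcases le_total i N with h | h
      · exact ⟨0, i, by omega, h, by omega⟩
      · exact ⟨i - N, N, by omega, le_rfl, by omega⟩
    refine ⟨dualPolynomial N fun i => a (s + i), dualPolynomial_ne_zero hj hi,
      isApolar_dualPolynomial hiso fun h hh => ?_⟩
    rw [← hh.vanish s hs, mul_comm, momentFunctional_mul_eq_sum a _ hh.natDegree_le]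
    simp only [← pow_add, momentFunctional_X_pow]
  have hex : ∃ e h, h ≠ 0 ∧ IsApolar a d e h := ⟨N, hexN⟩
  obtain ⟨e, he⟩ : ∃ e, Nat.find hex = e := ⟨_, rfl⟩
  obtain ⟨g, hg0, hg⟩ := Nat.find_spec hex
  have heN : Nat.find hex ≤ N := Nat.find_min' hex hexN
  have hmin : ∀ m < Nat.find hex, ∀ h, IsApolar a d m h → h = 0 := by
    intro m hm h hh
    by_contra hne
    exact Nat.find_min hex hm ⟨h, hne, hh⟩
  rw [he] at hg heN hmin
  have he1 : 1 ≤ e := by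
    by_contra hlt
    obtain rfl : e = 0 := by omega
    obtain ⟨i, hid, hi⟩ := ha
    have hv := hg.vanish i hid
    rw [Polynomial.eq_C_of_natDegree_le_zero hg.natDegree_le] at hv hg0
    rw [← Polynomial.smul_eq_C_mul, map_smul, momentFunctional_X_pow, smul_eq_mul] at hv
    rcases mul_eq_zero.1 hv with h | h
    · exact hg0 (by rw [h, map_zero])
    · exact hi h
  have hdvd : ∀ h, IsApolar a d N h → ∃ u : Polynomial ℂ, h = g * u ∧
      (u = 0 ∨ u.natDegree + e ≤ N) :=
    fun h hh => hg.exists_eq_mul hg0 hmin he1 hh (by omega)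
  have hdual : ∀ φ : ℕ → ℂ, (∃ i ≤ N, φ i ≠ 0) →
      (∀ h, IsApolar a d N h → ∑ i ∈ Finset.range (N + 1), h.coeff i * φ i = 0) →
      ∃ u : Polynomial ℂ, dualPolynomial N φ = g * u ∧ u.natDegree + e ≤ N ∧
        (dualPolynomial N φ).natDegree = g.natDegree + u.natDegree := by
    rintro φ ⟨i, hiN, hi⟩ hφ
    have hne := dualPolynomial_ne_zero hiN hi
    obtain ⟨u, hu, hdeg⟩ := hdvd _ (isApolar_dualPolynomial hiso hφ)
    have hu0 : u ≠ 0 := by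
      rintro rfl
      exact hne (by rw [hu, mul_zero])
    exact ⟨u, hu, hdeg.resolve_left hu0, by rw [hu, Polynomial.natDegree_mul hg0 hu0]⟩
  refine ⟨e, ?_⟩
  by_cases hdeg0 : g.natDegree = 0
  · obtain ⟨c, rfl⟩ : ∃ c, g = Polynomial.C c := ⟨_, Polynomial.eq_C_of_natDegree_eq_zero hdeg0⟩
    have hc : c ≠ 0 := by
      rintro rfl
      exact hg0 (map_zero _)
    constructor
    · obtain ⟨u, -, h2, h3⟩ := hdual (fun i => if i = N - e + 1 then 1 else 0)
        ⟨N - e + 1, by omega, by simp⟩ (fun h hh => by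
          obtain ⟨u, rfl, hu⟩ := hdvd h hh
          refine Finset.sum_eq_zero fun i _ => ?_
          split_ifs with hi
          · rw [mul_one, Polynomial.coeff_C_mul]
            rcases hu with rfl | hu
            · simp
            · rw [Polynomial.coeff_eq_zero_of_natDegree_lt (by omega), mul_zero]
          · rw [mul_zero])
      have h4 : e - 1 ≤ (dualPolynomial N fun i => if i = N - e + 1 then 1 else 0).natDegree := by
        refine Polynomial.le_natDegree_of_ne_zero ?_
        have hidx : e - 1 = N - (N - e + 1) := by omega
        rw [hidx, coeff_dualPolynomial N _ (by omega), if_pos rfl, mul_one]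
        have hch : (N.choose (N - e + 1) : ℂ) ≠ 0 := by
          exact_mod_cast (Nat.choose_pos (by omega)).ne'
        exact mul_ne_zero hch (pow_ne_zero _ (by norm_num))
      omega
    · right
      have := hg.mul (u := Polynomial.C c⁻¹) (n := e) (by simp)
      rwa [← map_mul, mul_inv_cancel₀ hc, map_one] at this
  · obtain ⟨μ, hμ⟩ := IsAlgClosed.exists_root g
      (fun h => hdeg0 (Polynomial.natDegree_eq_of_degree_eq_some h))
    obtain ⟨u, h1, h2, h3⟩ := hdual (fun i => μ ^ i) ⟨0, by omega, by simp⟩ (fun h hh => by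
      obtain ⟨u, rfl, -⟩ := hdvd h hh
      rw [← Polynomial.eval_eq_sum_range' (Nat.lt_succ_of_le hh.natDegree_le),
        Polynomial.eval_mul, hμ.eq_zero, zero_mul])
    rw [dualPolynomial_pow] at h1 h3
    rw [Polynomial.natDegree_pow, Polynomial.natDegree_X_sub_C, mul_one] at h3
    have hge : g.natDegree = e := le_antisymm hg.natDegree_le (by omega)
    obtain ⟨i, -, hi⟩ := (dvd_prime_pow (Polynomial.prime_X_sub_C μ) N).1 ⟨u, h1⟩
    have hie : i = e := by
      have := Polynomial.natDegree_eq_of_degree_eq (Polynomial.degree_eq_degree_of_associated hi)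
      rw [Polynomial.natDegree_pow, Polynomial.natDegree_X_sub_C, mul_one] at this
      omega
    rw [hie] at hi
    constructor
    · obtain ⟨v, -, -, h6⟩ := hdual (fun i => (i.choose (e - 1) : ℂ) * μ ^ (i - (e - 1)))
        ⟨e - 1, by omega, by simp⟩ (fun h hh => by
          obtain ⟨w, rfl, -⟩ := hdvd h hh
          exact sum_coeff_mul_choose_eq_zero hh.natDegree_le (by omega)
            (hi.symm.dvd.trans (Dvd.intro w rfl)))
      have h7 := natDegree_dualPolynomial_le_sub (N := N) (r := e - 1)
        (φ := fun i => (i.choose (e - 1) : ℂ) * μ ^ (i - (e - 1)))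
        (fun i hi => by simp [Nat.choose_eq_zero_of_lt hi])
      omega
    · left
      refine ⟨μ, ?_⟩
      obtain ⟨v, hv⟩ := hi
      rw [← hv]
      exact hg.mul (by rw [Polynomial.natDegree_eq_zero_of_isUnit v.isUnit, zero_add])

theorem momentFunctional_map (a : ℕ → ℂ) (p : Polynomial ℂ) :
    momentFunctional (fun i => (C (a i) : MvPolynomial (Fin 2) ℂ)) (p.map C) =
      C (momentFunctional a p) := by
  have hdeg : (p.map (C : ℂ →+* MvPolynomial (Fin 2) ℂ)).natDegree ≤ p.natDegree :=
    Polynomial.natDegree_map_le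
  rw [momentFunctional_eq_sum _ hdeg, momentFunctional_eq_sum a le_rfl, map_sum]
  simp

theorem binaryForm_eq_momentFunctional (d : ℕ) (a : ℕ → ℂ) :
    binaryForm d a = momentFunctional (fun i => (C (a i) : MvPolynomial (Fin 2) ℂ))
      ((Polynomial.X * Polynomial.C (X 1) + Polynomial.C (X 0)) ^ d) := by
  rw [add_pow, map_sum]
  unfold binaryForm
  refine Finset.sum_congr rfl fun i _ => ?_
  have : (Polynomial.X * Polynomial.C (X 1)) ^ i * Polynomial.C (X 0) ^ (d - i) *
      (d.choose i : Polynomial (MvPolynomial (Fin 2) ℂ)) =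
      ((d.choose i : MvPolynomial (Fin 2) ℂ) * (X 0 ^ (d - i) * X 1 ^ i)) •
        Polynomial.X ^ i := by
    rw [Polynomial.smul_eq_C_mul]
    simp only [map_mul, map_pow, map_natCast]
    ring
  rw [this, map_smul, momentFunctional_X_pow, smul_eq_mul, map_mul, map_natCast]
  ring

theorem pow_dvd_binaryForm_of_isApolar {a : ℕ → ℂ} {d e : ℕ} {μ : ℂ} (he : e ≤ d)
    (h : IsApolar a d e ((Polynomial.X - Polynomial.C μ) ^ e)) :
    (C 1 * X 0 + C μ * X 1) ^ (d - e + 1) ∣ binaryForm d a := by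
  have heq : (Polynomial.X * Polynomial.C (X 1) + Polynomial.C (X 0) :
      Polynomial (MvPolynomial (Fin 2) ℂ)) =
      (Polynomial.X - Polynomial.C μ).map C * Polynomial.C (X 1) +
        Polynomial.C (C 1 * X 0 + C μ * X 1) := by
    simp only [Polynomial.map_sub, Polynomial.map_X, Polynomial.map_C, map_add, map_mul, map_one]
    ring
  rw [binaryForm_eq_momentFunctional, heq,
    add_pow (_ * _) (Polynomial.C _), map_sum]
  refine Finset.dvd_sum fun r hr => ?_
  have hr : r ≤ d := by simpa [Nat.lt_succ_iff] using hr
  have hterm : ((Polynomial.X - Polynomial.C μ).map C * Polynomial.C (X 1)) ^ r *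
      Polynomial.C (C 1 * X 0 + C μ * X 1) ^ (d - r) *
      (d.choose r : Polynomial (MvPolynomial (Fin 2) ℂ)) =
      ((C 1 * X 0 + C μ * X 1) ^ (d - r) * (X 1 ^ r * (d.choose r : MvPolynomial (Fin 2) ℂ))) •
        ((Polynomial.X - Polynomial.C μ) ^ r).map (C : ℂ →+* MvPolynomial (Fin 2) ℂ) := by
    rw [Polynomial.smul_eq_C_mul, Polynomial.map_pow]
    simp only [map_mul, map_pow, map_natCast]
    ring
  rw [hterm, map_smul, momentFunctional_map, smul_eq_mul]
  rcases lt_or_ge r e with hlt | hge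
  · exact ((pow_dvd_pow _ (by omega)).mul_right _).mul_right _
  · obtain ⟨j, rfl⟩ := Nat.exists_eq_add_of_le hge
    rw [pow_add (Polynomial.X - Polynomial.C μ), h.momentFunctional_mul]
    · simp
    · rw [Polynomial.natDegree_pow, Polynomial.natDegree_X_sub_C]
      omega

theorem X_one_pow_dvd_binaryForm_of_isApolar {a : ℕ → ℂ} {d e : ℕ} (he : e ≤ d)
    (h : IsApolar a d e 1) :
    X 1 ^ (d - e + 1) ∣ binaryForm d a := by
  unfold binaryForm
  refine Finset.dvd_sum fun i _ => ?_
  rcases le_or_gt (i + e) d with hle | hlt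
  · have := h.vanish i hle
    rw [one_mul, momentFunctional_X_pow] at this
    simp [this]
  · exact ((pow_dvd_pow _ (by omega)).mul_left _).mul_left _

/-- (Weyman) Let `f ∈ V_d` and `k ≥ 1` with `d > 4k − 4`. If the transvectants
`(f,f)_{2j}` vanish for all `j` with `k ≤ j ≤ ⌊d/2⌋`, then `f` has a root of
multiplicity at least `d − k + 1`. -/
theorem weyman_strict (d k : ℕ) (hk : 1 ≤ k) (hd : 4 * k - 4 < d)
    (f : MvPolynomial (Fin 2) ℂ) (hf : f.IsHomogeneous d)
    (hvan : ∀ j : ℕ, k ≤ j → j ≤ d / 2 → transv d d (2 * j) f f = 0) :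
    HasRootOfMult (d - k + 1) f := by
  obtain ⟨a, rfl⟩ := eq_binaryForm_of_isHomogeneous hf
  by_cases ha : ∃ i ≤ d, a i ≠ 0
  · obtain ⟨e, hek, ⟨μ, hμ⟩ | h1⟩ := exists_isApolar_pow hk hd
      (fun s t hs ht => alternatingProduct_eq_zero hk hvan _ s t le_rfl hs ht) ha
    · exact ⟨1, μ, Or.inl one_ne_zero,
        (pow_dvd_pow _ (by omega)).trans (pow_dvd_binaryForm_of_isApolar (by omega) hμ)⟩
    · refine ⟨0, 1, Or.inr one_ne_zero, ?_⟩
      rw [map_zero, zero_mul, zero_add, map_one, one_mul]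
      exact (pow_dvd_pow _ (by omega)).trans (X_one_pow_dvd_binaryForm_of_isApolar (by omega) h1)
  · push Not at ha
    refine ⟨1, 0, Or.inl one_ne_zero, ?_⟩
    have hzero : binaryForm d a = 0 := by
      unfold binaryForm
      refine Finset.sum_eq_zero fun i hi => ?_
      rw [ha i (Nat.lt_succ_iff.1 (Finset.mem_range.1 hi))]
      simp
    rw [hzero]
    exact dvd_zero _
end

section
/- (Weyman) Let f ∈ V_d be a binary form of degree d and let k ≥ 1 with d = 4k − 4. If the transvectant ((f,f)_{2k−2}, f)_d vanishes and the transvectants (f,f)_{2j} vanish for all j with k ≤ j ≤ ⌊d/2⌋, then f has a root of multiplicity at least d − k + 1. -/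
open MvPolynomial

/-- The binary form `∑ j, n.choose j * a j * x ^ (n - j) * y ^ j`, defined by the Pascal
recursion. -/
noncomputable def binForm {R : Type*} [CommRing R] [Algebra ℂ R] : ℕ → (ℕ → ℂ) → R → R → R
  | 0, a, _, _ => algebraMap ℂ R (a 0)
  | n + 1, a, x, y => x * binForm n a x y + y * binForm n (fun i => a (i + 1)) x y

section binForm

variable {R : Type*} [CommRing R] [Algebra ℂ R]

theorem binForm_add (n : ℕ) (a b : ℕ → ℂ) (x y : R) :
    binForm n (fun i => a i + b i) x y = binForm n a x y + binForm n b x y := by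
  induction n generalizing a b with
  | zero => simp [binForm]
  | succ n ih =>
    simp only [binForm, ih]
    ring

theorem binForm_smul (n : ℕ) (c : ℂ) (a : ℕ → ℂ) (x y : R) :
    binForm n (fun i => c * a i) x y = c • binForm n a x y := by
  induction n generalizing a with
  | zero => simp [binForm, Algebra.smul_def]
  | succ n ih =>
    simp only [binForm, ih]
    rw [smul_add, mul_smul_comm, mul_smul_comm]

theorem binForm_eq_sum (n : ℕ) (a : ℕ → ℂ) (x y : R) :
    binForm n a x y =
      ∑ j ∈ Finset.range (n + 1), ((n.choose j : ℂ) * a j) • (x ^ (n - j) * y ^ j) := by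
  induction n generalizing a with
  | zero => simp [binForm, Algebra.smul_def]
  | succ n ih =>
    simp only [binForm, ih]
    rw [Finset.sum_range_succ' _ (n + 1), Finset.mul_sum, Finset.mul_sum,
      Finset.sum_range_succ' _ n]
    have h : ∀ j ∈ Finset.range (n + 1),
        (((n + 1).choose (j + 1) : ℂ) * a (j + 1)) • (x ^ (n + 1 - (j + 1)) * y ^ (j + 1)) =
        y * (((n.choose j : ℂ) * a (j + 1)) • (x ^ (n - j) * y ^ j)) +
        ((n.choose (j + 1) : ℂ) * a (j + 1)) • (x ^ (n - j) * y ^ (j + 1)) := by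
      intro j _
      rw [Nat.choose_succ_succ, mul_smul_comm, Nat.add_sub_add_right]
      push_cast
      rw [add_mul, add_smul]
      congr 2
      ring
    rw [Finset.sum_congr rfl h, Finset.sum_add_distrib, Finset.sum_range_succ
      (fun j => ((n.choose (j + 1) : ℂ) * a (j + 1)) • (x ^ (n - j) * y ^ (j + 1)))]
    have h2 : ∀ j ∈ Finset.range n,
        x * (((n.choose (j + 1) : ℂ) * a (j + 1)) • (x ^ (n - (j + 1)) * y ^ (j + 1))) =
        ((n.choose (j + 1) : ℂ) * a (j + 1)) • (x ^ (n - j) * y ^ (j + 1)) := by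
      intro j hj
      rw [mul_smul_comm]
      obtain ⟨k, rfl⟩ := Nat.exists_eq_add_of_lt (Finset.mem_range.1 hj)
      rw [show j + k + 1 - (j + 1) = k by omega, show j + k + 1 - j = k + 1 by omega]
      congr 1
      ring
    rw [Finset.sum_congr rfl h2]
    simp only [Nat.choose_succ_self, Nat.cast_zero, zero_mul, zero_smul, add_zero, Nat.choose_zero_right,
      Nat.cast_one, one_mul, pow_zero, mul_one, Nat.sub_zero, mul_smul_comm, pow_succ']
    ring

theorem binForm_reverse (n : ℕ) (a : ℕ → ℂ) (x y : R) :
    binForm n (fun i => a (n - i)) x y = binForm n a y x := by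
  rw [binForm_eq_sum, binForm_eq_sum, ← Finset.sum_range_reflect]
  refine Finset.sum_congr rfl fun j hj => ?_
  have hj' := Nat.lt_succ_iff.1 (Finset.mem_range.1 hj)
  rw [show n + 1 - 1 - j = n - j by omega, Nat.choose_symm hj', Nat.sub_sub_self hj', mul_comm (x ^ j)]

/-- The coefficient sequence of a binary form after the substitution `x ↦ x + c y`. -/
noncomputable def shear (c : ℂ) (a : ℕ → ℂ) (n : ℕ) : ℂ := binForm n a c 1

theorem shear_eq_sum (c : ℂ) (a : ℕ → ℂ) (n : ℕ) :
    shear c a n = ∑ j ∈ Finset.range (n + 1), (n.choose j : ℂ) * a j * c ^ (n - j) := by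
  simp [shear, binForm_eq_sum]

theorem shear_succ (c : ℂ) (a : ℕ → ℂ) (n : ℕ) :
    shear c a (n + 1) = c * shear c a n + shear c (fun i => a (i + 1)) n := by
  simp [shear, binForm]

theorem binForm_shear (n : ℕ) (c : ℂ) (a : ℕ → ℂ) (x y : R) :
    binForm n (shear c a) x y = binForm n a (x + c • y) y := by
  induction n generalizing a with
  | zero => rfl
  | succ n ih =>
    simp only [binForm, shear_succ]
    rw [binForm_add, binForm_smul, ih, ih, Algebra.smul_def, Algebra.smul_def]
    ring

theorem shear_shear (c e : ℂ) (a : ℕ → ℂ) :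
    shear e (shear c a) = shear (e + c) a := by
  funext n
  change binForm n (shear c a) e 1 = binForm n a (e + c) 1
  rw [binForm_shear, smul_eq_mul, mul_one]

theorem shear_by_zero (a : ℕ → ℂ) : shear 0 a = a := by
  funext n
  rw [shear_eq_sum, Finset.sum_eq_single n]
  · simp
  · intro j hj hjn
    have := Finset.mem_range.1 hj
    rw [zero_pow (by omega), mul_zero]
  · simp

theorem shear_eq_zero {e : ℕ} {a : ℕ → ℂ} (h : ∀ i < e, a i = 0) (c : ℂ) :
    ∀ i < e, shear c a i = 0 := by
  intro i hi
  rw [shear_eq_sum]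
  refine Finset.sum_eq_zero fun j hj => ?_
  rw [h j (by have := Finset.mem_range.1 hj; omega)]
  simp

theorem shear_apply_order {e : ℕ} {a : ℕ → ℂ} (h : ∀ i < e, a i = 0) (c : ℂ) :
    shear c a e = a e := by
  rw [shear_eq_sum, Finset.sum_range_succ, Finset.sum_eq_zero]
  · simp
  · intro j hj
    rw [h j (Finset.mem_range.1 hj)]
    simp

theorem coeff_binForm (n : ℕ) (a : ℕ → ℂ) (l : ℕ) :
    (binForm n a (1 : Polynomial ℂ) Polynomial.X).coeff l = (n.choose l : ℂ) * a l := by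
  rw [binForm_eq_sum]
  simp only [one_pow, one_mul, Polynomial.finsetSum_coeff, Polynomial.coeff_smul,
    Polynomial.coeff_X_pow, smul_eq_mul, mul_ite, mul_one, mul_zero]
  rw [Finset.sum_ite_eq]
  split_ifs with h
  · rfl
  · rw [Nat.choose_eq_zero_of_lt (by simpa [Nat.lt_succ_iff] using h)]
    simp

theorem map_binForm {S : Type*} [CommRing S] [Algebra ℂ S] (φ : R →ₐ[ℂ] S) (n : ℕ) (a : ℕ → ℂ)
    (x y : R) : φ (binForm n a x y) = binForm n a (φ x) (φ y) := by
  induction n generalizing a with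
  | zero => simp [binForm]
  | succ n ih => simp [binForm, ih]

end binForm

section Transvectant

theorem pderiv_zero_binForm (n : ℕ) (a : ℕ → ℂ) :
    pderiv (0 : Fin 2) (binForm (n + 1) a (X 0 : MvPolynomial (Fin 2) ℂ) (X 1)) =
      ((n + 1 : ℕ) : ℂ) • binForm n a (X 0 : MvPolynomial (Fin 2) ℂ) (X 1) := by
  induction n generalizing a with
  | zero => simp [binForm, pderiv_X, algebraMap_eq]
  | succ n ih =>
    rw [binForm]
    simp only [map_add, Derivation.leibniz, ih, pderiv_X, smul_eq_mul]
    simp only [Pi.single_eq_same, ne_eq, one_ne_zero, not_false_eq_true, Pi.single_eq_of_ne, mul_one,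
      mul_zero, add_zero, MvPolynomial.smul_eq_C_mul]
    rw [show binForm (n + 1) a (X 0 : MvPolynomial (Fin 2) ℂ) (X 1) =
      X 0 * binForm n a (X 0) (X 1) +
      X 1 * binForm n (fun i => a (i + 1)) (X 0 : MvPolynomial (Fin 2) ℂ) (X 1) from rfl]
    push_cast
    simp only [map_add, map_one]
    ring

theorem pderiv_one_binForm (n : ℕ) (a : ℕ → ℂ) :
    pderiv (1 : Fin 2) (binForm (n + 1) a (X 0 : MvPolynomial (Fin 2) ℂ) (X 1)) =
      ((n + 1 : ℕ) : ℂ) •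
        binForm n (fun i => a (i + 1)) (X 0 : MvPolynomial (Fin 2) ℂ) (X 1) := by
  induction n generalizing a with
  | zero => simp [binForm, pderiv_X, algebraMap_eq]
  | succ n ih =>
    rw [binForm]
    simp only [map_add, Derivation.leibniz, ih, pderiv_X, smul_eq_mul]
    simp only [Pi.single_eq_same, ne_eq, zero_ne_one, not_false_eq_true, Pi.single_eq_of_ne, mul_one,
      mul_zero, add_zero, MvPolynomial.smul_eq_C_mul]
    rw [show binForm (n + 1) (fun i => a (i + 1)) (X 0 : MvPolynomial (Fin 2) ℂ) (X 1) =
      X 0 * binForm n (fun i => a (i + 1)) (X 0 : MvPolynomial (Fin 2) ℂ) (X 1) +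
      X 1 * binForm n (fun i => a (i + 1 + 1)) (X 0 : MvPolynomial (Fin 2) ℂ) (X 1) from rfl]
    push_cast
    simp only [map_add, map_one]
    ring

theorem pderiv_zero_iterate_binForm (n q : ℕ) (a : ℕ → ℂ) :
    (fun p => pderiv (0 : Fin 2) p)^[q] (binForm (n + q) a (X 0 : MvPolynomial (Fin 2) ℂ) (X 1)) =
      ((n + q).descFactorial q : ℂ) • binForm n a (X 0 : MvPolynomial (Fin 2) ℂ) (X 1) := by
  induction q generalizing n with
  | zero => simp
  | succ q ih =>
    rw [Function.iterate_succ_apply', show n + (q + 1) = (n + 1) + q by ring, ih, Derivation.map_smul,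
      pderiv_zero_binForm, smul_smul, Nat.descFactorial_succ, show n + 1 + q - q = n + 1 by omega]
    push_cast
    ring_nf

theorem pderiv_one_iterate_binForm (n q : ℕ) (a : ℕ → ℂ) :
    (fun p => pderiv (1 : Fin 2) p)^[q] (binForm (n + q) a (X 0 : MvPolynomial (Fin 2) ℂ) (X 1)) =
      ((n + q).descFactorial q : ℂ) •
        binForm n (fun i => a (i + q)) (X 0 : MvPolynomial (Fin 2) ℂ) (X 1) := by
  induction q generalizing n with
  | zero => simp
  | succ q ih =>
    rw [Function.iterate_succ_apply', show n + (q + 1) = (n + 1) + q by ring, ih, Derivation.map_smul,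
      pderiv_one_binForm, smul_smul, Nat.descFactorial_succ, show n + 1 + q - q = n + 1 by omega]
    rw [show (fun i => a (i + 1 + q)) = fun i => a (i + (q + 1)) by funext i; congr 1; ring,
      show n + 1 + q = n + (q + 1) by ring]
    push_cast
    rw [mul_comm]

theorem pderiv_iterate_smul (i : Fin 2) (q : ℕ) (c : ℂ) (f : MvPolynomial (Fin 2) ℂ) :
    (fun p => pderiv i p)^[q] (c • f) = c • (fun p => pderiv i p)^[q] f := by
  induction q generalizing f with
  | zero => rfl
  | succ q ih => rw [Function.iterate_succ_apply, Derivation.map_smul, ih, Function.iterate_succ_apply]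

theorem pderiv_iterate_binForm (n p q : ℕ) (a : ℕ → ℂ) :
    (fun g => pderiv (0 : Fin 2) g)^[p]
      ((fun g => pderiv (1 : Fin 2) g)^[q]
        (binForm (n + (p + q)) a (X 0 : MvPolynomial (Fin 2) ℂ) (X 1))) =
      ((n + (p + q)).descFactorial (p + q) : ℂ) •
        binForm n (fun i => a (i + q)) (X 0 : MvPolynomial (Fin 2) ℂ) (X 1) := by
  rw [← add_assoc, pderiv_one_iterate_binForm, pderiv_iterate_smul, pderiv_zero_iterate_binForm,
    smul_smul, ← Nat.cast_mul]
  congr 2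
  have h := Nat.descFactorial_mul_descFactorial (k := q) (m := p + q) (n := n + p + q) (by omega)
  rw [← h]
  simp only [Nat.add_sub_cancel]
  ring

theorem transv_binForm (n m k : ℕ) (a b : ℕ → ℂ) :
    transv (n + k) (m + k) k (binForm (n + k) a (X 0 : MvPolynomial (Fin 2) ℂ) (X 1))
        (binForm (m + k) b (X 0) (X 1)) =
      ∑ i ∈ Finset.range (k + 1), ((-1 : ℂ) ^ i * (k.choose i : ℂ)) •
        (binForm n (fun j => a (j + i)) (X 0 : MvPolynomial (Fin 2) ℂ) (X 1) *
          binForm m (fun j => b (j + (k - i))) (X 0 : MvPolynomial (Fin 2) ℂ) (X 1)) := by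
  have key : ∀ i ∈ Finset.range (k + 1), ((-1 : ℂ) ^ i * (k.choose i : ℂ)) •
      ((fun p => pderiv (0 : Fin 2) p)^[k - i]
          ((fun p => pderiv (1 : Fin 2) p)^[i]
            (binForm (n + k) a (X 0 : MvPolynomial (Fin 2) ℂ) (X 1))) *
        (fun p => pderiv (0 : Fin 2) p)^[i]
          ((fun p => pderiv (1 : Fin 2) p)^[k - i]
            (binForm (m + k) b (X 0 : MvPolynomial (Fin 2) ℂ) (X 1)))) =
      (((n + k).descFactorial k : ℂ) * ((m + k).descFactorial k : ℂ)) •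
        (((-1 : ℂ) ^ i * (k.choose i : ℂ)) •
        (binForm n (fun j => a (j + i)) (X 0 : MvPolynomial (Fin 2) ℂ) (X 1) *
          binForm m (fun j => b (j + (k - i))) (X 0 : MvPolynomial (Fin 2) ℂ) (X 1))) := by
    intro i hi
    have hik : i ≤ k := Nat.lt_succ_iff.1 (Finset.mem_range.1 hi)
    have h1 := pderiv_iterate_binForm n (k - i) i a
    have h2 := pderiv_iterate_binForm m i (k - i) b
    rw [Nat.sub_add_cancel hik] at h1
    rw [Nat.add_sub_cancel' hik] at h2
    rw [h1, h2, smul_mul_smul_comm, smul_smul, smul_smul, mul_comm]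
  rw [transv, Finset.sum_congr rfl key, ← Finset.smul_sum, smul_smul]
  convert one_smul ℂ _
  rw [Nat.add_sub_cancel, Nat.add_sub_cancel]
  have h1 := Nat.factorial_mul_descFactorial (Nat.le_add_left k n)
  have h2 := Nat.factorial_mul_descFactorial (Nat.le_add_left k m)
  rw [Nat.add_sub_cancel] at h1 h2
  rw [div_mul_eq_mul_div, div_eq_one_iff_eq, ← h1, ← h2]
  · push_cast
    ring
  · exact_mod_cast mul_ne_zero (Nat.factorial_ne_zero _) (Nat.factorial_ne_zero _)

/-- The coefficient of `x ^ (2 * (d - n) - p) * y ^ p` in the `n`-th transvectant of a form with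
itself. -/
theorem sum_eq_zero_of_transv_self_eq_zero {d n : ℕ} (hn : n ≤ d) {a : ℕ → ℂ}
    (h : transv d d n (binForm d a (X 0 : MvPolynomial (Fin 2) ℂ) (X 1))
      (binForm d a (X 0) (X 1)) = 0) (p : ℕ) :
    ∑ x ∈ Finset.HasAntidiagonal.antidiagonal p, ((d - n).choose x.1 : ℂ) * ((d - n).choose x.2 : ℂ) *
      ∑ i ∈ Finset.range (n + 1), (-1 : ℂ) ^ i * (n.choose i : ℂ) * (a (x.1 + i) * a (x.2 + (n - i)))
      = 0 := by
  obtain ⟨e, rfl⟩ := Nat.exists_eq_add_of_le' hn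
  rw [transv_binForm] at h
  have h2 := congrArg (aeval (![1, Polynomial.X] : Fin 2 → Polynomial ℂ)) h
  simp only [map_sum, map_smul, map_mul, map_binForm, aeval_X, map_zero, Matrix.cons_val_zero,
    Matrix.cons_val_one] at h2
  have h3 := congrArg (fun P => Polynomial.coeff P p) h2
  simp only [Polynomial.finsetSum_coeff, Polynomial.coeff_smul, Polynomial.coeff_mul, coeff_binForm,
    smul_eq_mul, Polynomial.coeff_zero] at h3
  rw [← h3, Nat.add_sub_cancel]
  simp only [Finset.mul_sum]
  rw [Finset.sum_comm]
  refine Finset.sum_congr rfl fun i _ => Finset.sum_congr rfl fun x _ => ?_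
  ring

end Transvectant

section ProductInterpolation

theorem eq_zero_of_natDegree_lt_card_of_eval_natCast {P : Polynomial ℂ} {S : Finset ℕ}
    (hS : P.natDegree < S.card) (h : ∀ i ∈ S, P.eval (i : ℂ) = 0) : P = 0 := by
  refine Polynomial.eq_zero_of_natDegree_lt_card_of_eval_eq_zero' P
    (S.map Nat.castEmbedding) ?_ (by simpa using hS)
  simpa using h

/-- For each `w ≤ D`, the products `b i * b (w - i)` with `i, w - i ≤ N` are the values at `i` of a
polynomial of degree at most `2 * m`. -/
def ProductInterpolation (m N D : ℕ) (b : ℕ → ℂ) : Prop :=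
  ∀ w ≤ D, ∃ P : Polynomial ℂ, P.natDegree ≤ 2 * m ∧
    ∀ i j, i ≤ N → j ≤ N → i + j = w → P.eval (i : ℂ) = b i * b j

namespace ProductInterpolation

variable {m N D : ℕ} {b : ℕ → ℂ}

theorem mono {N' D' : ℕ} (h : ProductInterpolation m N D b) (hN : N' ≤ N) (hD : D' ≤ D) :
    ProductInterpolation m N' D' b := by
  intro w hw
  obtain ⟨P, hP, hP'⟩ := h w (hw.trans hD)
  exact ⟨P, hP, fun i j hi hj => hP' i j (hi.trans hN) (hj.trans hN)⟩

protected theorem mul_eq_zero (h : ProductInterpolation m N D b) {w : ℕ} (hw : w ≤ D) (S : Finset ℕ)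
    (hcard : 2 * m < S.card)
    (hS : ∀ i ∈ S, i ≤ N ∧ i ≤ w ∧ w - i ≤ N ∧ (b i = 0 ∨ b (w - i) = 0))
    {i j : ℕ} (hi : i ≤ N) (hj : j ≤ N) (hij : i + j = w) : b i * b j = 0 := by
  obtain ⟨P, hP, hP'⟩ := h w hw
  have hP0 : P = 0 := by
    refine eq_zero_of_natDegree_lt_card_of_eval_natCast (hP.trans_lt hcard) fun l hl => ?_
    obtain ⟨h1, h2, h3, h4⟩ := hS l hl
    rw [hP' l (w - l) h1 h3 (by omega)]
    exact mul_eq_zero.2 h4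
  rw [← hP' i j hi hj hij, hP0, Polynomial.eval_zero]

theorem reverse {d : ℕ} (h : ProductInterpolation m d (2 * d) b) :
    ProductInterpolation m d (2 * d) (fun i => b (d - i)) := by
  intro w hw
  obtain ⟨P, hP, hP'⟩ := h (2 * d - w) (by omega)
  refine ⟨P.comp (Polynomial.C (d : ℂ) - Polynomial.X), ?_, fun i j hi hj hij => ?_⟩
  · refine Polynomial.natDegree_comp_le.trans ?_
    have : (Polynomial.C (d : ℂ) - Polynomial.X).natDegree ≤ 1 :=
      (Polynomial.natDegree_sub_le _ _).trans (by simp)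
    nlinarith
  · rw [← hP' (d - i) (d - j) (by omega) (by omega) (by omega)]
    simp [Nat.cast_sub hi]

theorem shift (h : ProductInterpolation m (D + 2) (D + 2) b) :
    ProductInterpolation m D D (fun i => b (i + 1)) := by
  intro w hw
  obtain ⟨P, hP, hP'⟩ := h (w + 2) (by omega)
  refine ⟨P.comp (Polynomial.X + Polynomial.C 1), ?_, fun i j hi hj hij => ?_⟩
  · rwa [Polynomial.natDegree_comp, Polynomial.natDegree_X_add_C, mul_one]
  · rw [← hP' (i + 1) (j + 1) (by omega) (by omega) (by omega)]
    simp

theorem shift_div (h : ProductInterpolation (m + 1) (D + 2) (D + 2) b) (hb : b 0 = 0) :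
    ProductInterpolation m D D (fun i => b (i + 1) / (i + 1)) := by
  intro w hw
  obtain ⟨P, hP, hP'⟩ := h (w + 2) (by omega)
  have h0 : P.IsRoot (0 : ℂ) := by
    have := hP' 0 (w + 2) (by omega) (by omega) (by omega)
    rw [hb, zero_mul] at this
    simpa using this
  obtain ⟨Q, rfl⟩ := Polynomial.dvd_iff_isRoot.2 h0
  have h1 : Q.IsRoot ((w + 2 : ℕ) : ℂ) := by
    have := hP' (w + 2) 0 (by omega) (by omega) (by omega)
    rw [hb, mul_zero, Polynomial.eval_mul] at this
    refine (mul_eq_zero.1 this).resolve_left ?_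
    simp only [map_zero, sub_zero, Polynomial.eval_X]
    exact Nat.cast_ne_zero.2 (Nat.succ_ne_zero _)
  obtain ⟨R, rfl⟩ := Polynomial.dvd_iff_isRoot.2 h1
  refine ⟨-R.comp (Polynomial.X + Polynomial.C 1), ?_, fun i j hi hj hij => ?_⟩
  · rw [Polynomial.natDegree_neg, Polynomial.natDegree_comp, Polynomial.natDegree_X_add_C, mul_one]
    by_cases hR : R = 0
    · simp [hR]
    rw [Polynomial.natDegree_mul (Polynomial.X_sub_C_ne_zero _)
      (mul_ne_zero (Polynomial.X_sub_C_ne_zero _) hR),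
      Polynomial.natDegree_mul (Polynomial.X_sub_C_ne_zero _) hR, Polynomial.natDegree_X_sub_C,
      Polynomial.natDegree_X_sub_C] at hP
    omega
  · have := hP' (i + 1) (j + 1) (by omega) (by omega) (by omega)
    have hi' : (i : ℂ) + 1 ≠ 0 := Nat.cast_add_one_ne_zero i
    have hj' : (j : ℂ) + 1 ≠ 0 := Nat.cast_add_one_ne_zero j
    rw [div_mul_div_comm, ← this, eq_div_iff (mul_ne_zero hi' hj'), ← hij]
    simp only [Polynomial.eval_mul, Polynomial.eval_sub, Polynomial.eval_X, Polynomial.eval_C,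
      Polynomial.eval_neg, Polynomial.eval_comp, Polynomial.eval_add]
    push_cast
    ring

end ProductInterpolation

theorem sum_choose_mul_choose (i j v : ℕ) :
    ∑ x ∈ Finset.HasAntidiagonal.antidiagonal v, (i.choose x.1 : ℂ) * (j.choose x.2 : ℂ) =
      ((i + j).choose v : ℂ) := by
  rw [Nat.add_choose_eq]
  push_cast
  rfl

/-- Vandermonde-weighted averages of polynomial values are polynomial of no larger degree. -/
theorem exists_eval_eq_sum_choose_mul_choose (n : ℕ) (P : Polynomial ℂ) (hP : P.natDegree ≤ n)
    (w v : ℕ) : ∃ Q : Polynomial ℂ, Q.natDegree ≤ n ∧ ∀ i j, i + j = w →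
      Q.eval (i : ℂ) = ∑ x ∈ Finset.HasAntidiagonal.antidiagonal v,
        (i.choose x.1 : ℂ) * (j.choose x.2 : ℂ) * P.eval (x.1 : ℂ) := by
  have const : ∀ (c : ℂ) (w v i j : ℕ), i + j = w →
      ∑ x ∈ Finset.HasAntidiagonal.antidiagonal v,
        (i.choose x.1 : ℂ) * (j.choose x.2 : ℂ) * c = (w.choose v : ℂ) * c := by
    rintro c w v i j rfl
    rw [← Finset.sum_mul, sum_choose_mul_choose]
  induction n generalizing P w v with
  | zero =>
    obtain ⟨c, rfl⟩ := Polynomial.natDegree_eq_zero.1 (Nat.le_zero.1 hP)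
    refine ⟨Polynomial.C ((w.choose v : ℂ) * c), (Polynomial.natDegree_C _).le, fun i j hij => ?_⟩
    simp only [Polynomial.eval_C]
    exact (const c w v i j hij).symm
  | succ n ih =>
    cases v with
    | zero => exact ⟨Polynomial.C (P.eval 0), by simp, fun i j _ => by simp⟩
    | succ v =>
      have hdeg : (P.divX.comp (Polynomial.X + Polynomial.C 1)).natDegree ≤ n := by
        rw [Polynomial.natDegree_comp, Polynomial.natDegree_X_add_C, mul_one,
          Polynomial.natDegree_divX_eq_natDegree_tsub_one]
        omega
      obtain ⟨Q, hQ, hQ'⟩ := ih (P.divX.comp (Polynomial.X + Polynomial.C 1)) hdeg (w - 1) v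
      refine ⟨Polynomial.X * Q.comp (Polynomial.X - Polynomial.C 1) +
        Polynomial.C ((w.choose (v + 1) : ℂ) * P.coeff 0), ?_, fun i j hij => ?_⟩
      · rw [Polynomial.natDegree_add_C]
        refine Polynomial.natDegree_mul_le.trans ?_
        rw [Polynomial.natDegree_X, Polynomial.natDegree_comp, Polynomial.natDegree_X_sub_C]
        omega
      · have hsplit : ∀ t : ℂ, P.eval t = P.divX.eval t * t + P.coeff 0 := fun t => by
          conv_lhs => rw [← Polynomial.divX_mul_X_add P]
          simp
        simp only [hsplit, mul_add, Finset.sum_add_distrib]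
        rw [const (P.coeff 0) w (v + 1) i j hij, Polynomial.eval_add, Polynomial.eval_C,
          Finset.Nat.antidiagonal_succ, Finset.sum_cons, Finset.sum_map]
        simp only [Nat.cast_zero, mul_zero, zero_add, Polynomial.eval_mul, Polynomial.eval_X,
          Polynomial.eval_comp, Polynomial.eval_sub, Polynomial.eval_C]
        congr 1
        cases i with
        | zero => simp
        | succ i =>
          have := hQ' i j (by omega)
          push_cast
          rw [add_sub_cancel_right, this, Finset.mul_sum]
          refine Finset.sum_congr rfl fun x _ => ?_
          have hc : ((i : ℂ) + 1) * (i.choose x.1 : ℂ) =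
              ((i + 1).choose (x.1 + 1) : ℂ) * ((x.1 : ℂ) + 1) := by
            exact_mod_cast Nat.add_one_mul_choose_eq i x.1
          simp only [Polynomial.eval_comp, Polynomial.eval_add, Polynomial.eval_X, Polynomial.eval_C,
            Function.Embedding.prodMap, Function.Embedding.coeFn_mk, Prod.map_fst, Prod.map_snd,
            Function.Embedding.refl_apply, Nat.succ_eq_add_one]
          push_cast
          linear_combination ((j.choose x.2 : ℂ) * P.divX.eval ((x.1 : ℂ) + 1)) * hc

theorem shear_mul_shear (c : ℂ) (b : ℕ → ℂ) (i j : ℕ) :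
    shear c b i * shear c b j = ∑ v ∈ Finset.range (i + j + 1), c ^ (i + j - v) *
      ∑ x ∈ Finset.HasAntidiagonal.antidiagonal v,
        (i.choose x.1 : ℂ) * (j.choose x.2 : ℂ) * (b x.1 * b x.2) := by
  rw [shear_eq_sum, shear_eq_sum, Finset.sum_mul_sum, ← Finset.sum_product',
    ← Finset.sum_fiberwise_of_maps_to (t := Finset.range (i + j + 1)) (g := fun x => x.1 + x.2)]
  · refine Finset.sum_congr rfl fun v _ => ?_
    rw [Finset.mul_sum]
    refine (Finset.sum_subset_zero_on_sdiff (s₁ := Finset.filter (fun x : ℕ × ℕ => x.1 + x.2 = v)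
      (Finset.range (i + 1) ×ˢ Finset.range (j + 1))) ?_ ?_ ?_)
    · intro x hx
      simpa using (Finset.mem_filter.1 hx).2
    · intro x hx
      simp only [Finset.mem_sdiff, Finset.HasAntidiagonal.mem_antidiagonal, Finset.mem_filter, Finset.mem_product,
        Finset.mem_range, not_and] at hx
      rcases lt_or_ge i x.1 with h | h
      · simp [Nat.choose_eq_zero_of_lt h]
      · have : j < x.2 := by
          by_contra h'
          exact hx.2 ⟨by omega, by omega⟩ hx.1
        simp [Nat.choose_eq_zero_of_lt this]
    · intro x hx
      simp only [Finset.mem_filter, Finset.mem_product, Finset.mem_range] at hx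
      rw [show i + j - v = (i - x.1) + (j - x.2) by omega, pow_add]
      ring
  · intro x hx
    simp only [Finset.mem_product, Finset.mem_range] at hx ⊢
    omega

protected theorem ProductInterpolation.shear {m N D : ℕ} {b : ℕ → ℂ} (h : ProductInterpolation m N D b)
    (c : ℂ) : ProductInterpolation m N D (shear c b) := by
  intro w hw
  have hex : ∀ v, ∃ Q : Polynomial ℂ, Q.natDegree ≤ 2 * m ∧ ∀ i j, v ≤ w → i ≤ N → j ≤ N →
      i + j = w → Q.eval (i : ℂ) = ∑ x ∈ Finset.HasAntidiagonal.antidiagonal v,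
        (i.choose x.1 : ℂ) * (j.choose x.2 : ℂ) * (b x.1 * b x.2) := by
    intro v
    rcases lt_or_ge w v with hv | hv
    · exact ⟨0, by simp, fun i j h' => by omega⟩
    obtain ⟨P, hP, hP'⟩ := h v (hv.trans hw)
    obtain ⟨Q, hQ, hQ'⟩ := exists_eval_eq_sum_choose_mul_choose (2 * m) P hP w v
    refine ⟨Q, hQ, fun i j _ hi hj hij => ?_⟩
    rw [hQ' i j hij]
    refine Finset.sum_congr rfl fun x hx => ?_
    rcases lt_or_ge i x.1 with h1 | h1
    · simp [Nat.choose_eq_zero_of_lt h1]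
    rcases lt_or_ge j x.2 with h2 | h2
    · simp [Nat.choose_eq_zero_of_lt h2]
    rw [hP' x.1 x.2 (h1.trans hi) (h2.trans hj) (Finset.HasAntidiagonal.mem_antidiagonal.1 hx)]
  choose Q hQ hQ' using hex
  refine ⟨∑ v ∈ Finset.range (w + 1), Polynomial.C (c ^ (w - v)) * Q v, ?_, ?_⟩
  · exact Polynomial.natDegree_sum_le_of_forall_le _ _ fun v _ =>
      (Polynomial.natDegree_C_mul_le _ _).trans (hQ v)
  · intro i j hi hj hij
    rw [shear_mul_shear, Polynomial.eval_finsetSum, hij]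
    refine Finset.sum_congr rfl fun v hv => ?_
    rw [Polynomial.eval_mul, Polynomial.eval_C, hQ' v i j (by simpa [Nat.lt_succ_iff] using hv) hi hj hij]

end ProductInterpolation

section VanishingShear

theorem shear_succ_of_apply_zero {b : ℕ → ℂ} (hb : b 0 = 0) (c : ℂ) (i : ℕ) :
    shear c b (i + 1) = (i + 1) * shear c (fun j => b (j + 1) / (j + 1)) i := by
  rw [shear_eq_sum, shear_eq_sum, Finset.sum_range_succ', hb, Finset.mul_sum]
  simp only [mul_zero, zero_mul, add_zero]
  refine Finset.sum_congr rfl fun j _ => ?_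
  have hc : ((i : ℂ) + 1) * (i.choose j : ℂ) = ((i + 1).choose (j + 1) : ℂ) * ((j : ℂ) + 1) := by
    exact_mod_cast Nat.add_one_mul_choose_eq i j
  have hj : (j : ℂ) + 1 ≠ 0 := Nat.cast_add_one_ne_zero j
  rw [Nat.add_sub_add_right, ← mul_assoc, ← mul_assoc, hc]
  field_simp

/-- Some shear of `b` vanishes on the interval `(m, K]`. -/
def HasVanishingShear (m K : ℕ) (b : ℕ → ℂ) : Prop :=
  ∃ c : ℂ, ∀ i, m < i → i ≤ K → shear c b i = 0

namespace HasVanishingShear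

variable {m K : ℕ} {b : ℕ → ℂ}

theorem of_eq_zero (h : ∀ i, m < i → i ≤ K → b i = 0) : HasVanishingShear m K b :=
  ⟨0, by rwa [shear_by_zero]⟩

theorem of_shear {c : ℂ} (h : HasVanishingShear m K (shear c b)) : HasVanishingShear m K b := by
  obtain ⟨e, he⟩ := h
  rw [shear_shear] at he
  exact ⟨_, he⟩

theorem of_shift_div (hb : b 0 = 0) (h : HasVanishingShear m K (fun j => b (j + 1) / (j + 1))) :
    HasVanishingShear (m + 1) (K + 1) b := by
  obtain ⟨c, hc⟩ := h
  refine ⟨c, fun i hi hi' => ?_⟩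
  obtain ⟨i, rfl⟩ := Nat.exists_eq_add_of_lt (Nat.zero_lt_of_lt hi)
  rw [zero_add] at hi hi' ⊢
  rw [shear_succ_of_apply_zero hb, hc i (by omega) (by omega), mul_zero]

theorem of_exponential {μ : ℂ} {S : Polynomial ℂ} (hS : S.natDegree ≤ m)
    (h : ∀ i ≤ K, b i = S.eval (i : ℂ) * μ ^ i) : HasVanishingShear m K b := by
  refine ⟨-μ, fun i hi hi' => ?_⟩
  have h0 := congrFun (Polynomial.fwdDiff_iter_eq_zero_of_degree_lt (P := S) (hS.trans_lt hi)) 0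
  rw [fwdDiff_iter_eq_sum_shift] at h0
  rw [shear_eq_sum, ← mul_zero (μ ^ i), ← Pi.zero_apply (M := fun _ : ℂ => ℂ) 0, ← h0, Finset.mul_sum]
  refine Finset.sum_congr rfl fun j hj => ?_
  have hj' : j ≤ i := Nat.lt_succ_iff.1 (Finset.mem_range.1 hj)
  obtain ⟨l, rfl⟩ := Nat.exists_eq_add_of_le hj'
  rw [h j (by omega), Nat.add_sub_cancel_left, neg_pow]
  simp only [zero_add, nsmul_eq_mul, mul_one, zsmul_eq_mul]
  push_cast
  ring

theorem eq_zero_or_exponential (h : HasVanishingShear m K b) :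
    (∀ i, m < i → i ≤ K → b i = 0) ∨ ∃ (μ : ℂ) (S : Polynomial ℂ), μ ≠ 0 ∧ S.natDegree ≤ m ∧
      ∀ i ≤ K, b i = S.eval (i : ℂ) * μ ^ i := by
  obtain ⟨c, hc⟩ := h
  rcases eq_or_ne c 0 with rfl | hc0
  · left
    rwa [shear_by_zero] at hc
  right
  have hμ : -c ≠ 0 := neg_ne_zero.2 hc0
  have hb : b = shear (-c) (shear c b) := by rw [shear_shear, neg_add_cancel, shear_by_zero]
  refine ⟨-c, ∑ j ∈ Finset.range (m + 1),
    Polynomial.C (shear c b j * ((-c) ^ j)⁻¹ * (j.factorial : ℂ)⁻¹) * descPochhammer ℂ j, hμ, ?_, ?_⟩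
  · refine Polynomial.natDegree_sum_le_of_forall_le _ _ fun j hj => ?_
    refine (Polynomial.natDegree_C_mul_le _ _).trans ?_
    rw [descPochhammer_natDegree]
    exact Nat.lt_succ_iff.1 (Finset.mem_range.1 hj)
  · intro i hi
    have hterm : ∀ j, (Polynomial.C (shear c b j * ((-c) ^ j)⁻¹ * (j.factorial : ℂ)⁻¹) *
        descPochhammer ℂ j).eval (i : ℂ) = shear c b j * ((-c) ^ j)⁻¹ * (i.choose j : ℂ) := by
      intro j
      rw [Polynomial.eval_mul, Polynomial.eval_C, descPochhammer_eval_eq_descFactorial,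
        Nat.descFactorial_eq_factorial_mul_choose]
      have : (j.factorial : ℂ) ≠ 0 := Nat.cast_ne_zero.2 (Nat.factorial_ne_zero j)
      push_cast
      field_simp
    conv_lhs => rw [hb]
    rw [shear_eq_sum, Polynomial.eval_finsetSum, Finset.sum_mul]
    simp only [hterm]
    have h1 : ∀ j ∈ Finset.range (i + 1), (i.choose j : ℂ) * shear c b j * (-c) ^ (i - j) =
        shear c b j * ((-c) ^ j)⁻¹ * (i.choose j : ℂ) * (-c) ^ i := by
      intro j hj
      obtain ⟨l, rfl⟩ := Nat.exists_eq_add_of_le (Nat.lt_succ_iff.1 (Finset.mem_range.1 hj))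
      rw [Nat.add_sub_cancel_left, pow_add]
      field_simp
    rw [Finset.sum_congr rfl h1]
    rcases le_total i m with him | him
    · refine Finset.sum_subset (Finset.range_mono (by omega)) fun j _ hj => ?_
      rw [Nat.choose_eq_zero_of_lt (by simpa [Nat.lt_succ_iff] using hj)]
      simp
    · refine (Finset.sum_subset (Finset.range_mono (by omega)) fun j hj hj' => ?_).symm
      rw [hc j (by simpa [Nat.lt_succ_iff] using hj')
        ((Nat.lt_succ_iff.1 (Finset.mem_range.1 hj)).trans hi)]
      simp

end HasVanishingShear

namespace ProductInterpolation

variable {m D : ℕ} {b : ℕ → ℂ}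

theorem eq_zero_of_apply_zero_ne_zero (h : ProductInterpolation m D D b) (h0 : b 0 ≠ 0)
    (hb : ∀ j, m < j → j ≤ 2 * m + 1 → b j = 0) : ∀ j, m < j → j ≤ D → b j = 0 := by
  intro j
  induction j using Nat.strong_induction_on with
  | _ j ih =>
    intro hj hjD
    by_cases hj' : j ≤ 2 * m + 1
    · exact hb j hj hj'
    refine (mul_eq_zero.1 (h.mul_eq_zero hjD (Finset.Icc 1 (j - 1)) ?_ ?_ (i := 0) (j := j)
      (by omega) hjD (by omega))).resolve_left h0
    · rw [Nat.card_Icc]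
      omega
    · intro i hi
      rw [Finset.mem_Icc] at hi
      refine ⟨by omega, by omega, by omega, ?_⟩
      rcases lt_or_ge m i with h1 | h1
      · exact Or.inl (ih i (by omega) h1 (by omega))
      · exact Or.inr (ih (j - i) (by omega) (by omega) (by omega))

theorem eq_zero_of_initial_gap (h : ProductInterpolation m D D b) (hD : 4 * m + 2 ≤ D)
    (h0 : b 0 ≠ 0) (hb : ∀ i, 1 ≤ i → i ≤ m + 1 → b i = 0) : ∀ j, m < j → j ≤ D → b j = 0 := by
  refine h.eq_zero_of_apply_zero_ne_zero h0 fun j hj hj' => ?_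
  rcases eq_or_ne j (m + 1) with rfl | hjm
  · exact hb _ (by omega) le_rfl
  refine mul_self_eq_zero.1 (h.mul_eq_zero (w := 2 * j) (by omega)
    (Finset.Icc 1 (m + 1) ∪ Finset.Icc (2 * j - m - 1) (2 * j - 1)) ?_ ?_ (by omega) (by omega)
    (by omega))
  · rw [Finset.card_union_of_disjoint, Nat.card_Icc, Nat.card_Icc]
    · omega
    · rw [Finset.disjoint_left]
      intro i
      simp only [Finset.mem_Icc]
      omega
  · intro i hi
    rw [Finset.mem_union, Finset.mem_Icc, Finset.mem_Icc] at hi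
    refine ⟨by omega, by omega, by omega, ?_⟩
    rcases hi with hi | hi
    · exact Or.inl (hb i (by omega) (by omega))
    · exact Or.inr (hb _ (by omega) (by omega))

theorem eq_zero_of_middle_gap (h : ProductInterpolation m D D b) (hD : 4 * m + 2 ≤ D)
    (h0 : b 0 ≠ 0) (hb : ∀ i, m + 2 ≤ i → i ≤ 2 * m + 2 → b i = 0) :
    ∀ j, m < j → j ≤ D → b j = 0 := by
  refine h.eq_zero_of_apply_zero_ne_zero h0 fun j hj hj' => ?_
  rcases eq_or_ne j (m + 1) with rfl | hjm
  · refine mul_self_eq_zero.1 (h.mul_eq_zero (w := 2 * m + 2) (by omega)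
      ((Finset.range (2 * m + 3)).erase (m + 1)) ?_ ?_ (by omega) (by omega) (by omega))
    · rw [Finset.card_erase_of_mem (by simp; omega), Finset.card_range]
      omega
    · intro i hi
      rw [Finset.mem_erase, Finset.mem_range] at hi
      refine ⟨by omega, by omega, by omega, ?_⟩
      rcases lt_or_ge (m + 1) i with h1 | h1
      · exact Or.inl (hb i (by omega) (by omega))
      · exact Or.inr (hb _ (by omega) (by omega))
  · exact hb j (by omega) (by omega)

theorem apply_zero_mul_eq (h : ProductInterpolation m D D b) {μ : ℂ} {S : Polynomial ℂ}
    (hS : S.natDegree ≤ m) {w : ℕ} (hmw : 2 * m + 2 ≤ w) (hw : w ≤ D)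
    (hb : ∀ j, 1 ≤ j → j < w → b j = S.eval (j : ℂ) * μ ^ j) :
    b 0 * b w = S.eval 0 * (S.eval (w : ℂ) * μ ^ w) := by
  obtain ⟨P, hP, hP'⟩ := h w hw
  set Q : Polynomial ℂ :=
    Polynomial.C (μ ^ w) * (S * S.comp (Polynomial.C (w : ℂ) - Polynomial.X)) with hQ
  have hQd : Q.natDegree ≤ 2 * m := by
    refine (Polynomial.natDegree_C_mul_le _ _).trans (Polynomial.natDegree_mul_le.trans ?_)
    have h1 : (Polynomial.C (w : ℂ) - Polynomial.X).natDegree ≤ 1 :=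
      (Polynomial.natDegree_sub_le _ _).trans (by simp)
    have h2 : (S.comp (Polynomial.C (w : ℂ) - Polynomial.X)).natDegree ≤ m :=
      Polynomial.natDegree_comp_le.trans (by nlinarith)
    omega
  have hPQ : P - Q = 0 := by
    refine eq_zero_of_natDegree_lt_card_of_eval_natCast (S := Finset.Icc 1 (w - 1)) ?_ ?_
    · refine (Polynomial.natDegree_sub_le_of_le hP hQd).trans_lt ?_
      rw [Nat.card_Icc, max_self]
      omega
    · intro i hi
      rw [Finset.mem_Icc] at hi
      obtain ⟨j, rfl⟩ := Nat.exists_eq_add_of_le (show i ≤ w by omega)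
      rw [Polynomial.eval_sub, hP' i j (by omega) (by omega) rfl, hb i hi.1 (by omega),
        hb j (by omega) (by omega), hQ]
      simp only [Polynomial.eval_mul, Polynomial.eval_C, Polynomial.eval_comp, Polynomial.eval_sub,
        Polynomial.eval_X]
      push_cast
      rw [add_sub_cancel_left]
      ring
  have := hP' 0 w (by omega) hw (by omega)
  rw [← this, sub_eq_zero.1 hPQ, hQ]
  simp only [Polynomial.eval_mul, Polynomial.eval_C, Polynomial.eval_comp, Polynomial.eval_sub,
    Polynomial.eval_X, Nat.cast_zero, sub_zero]
  ring

theorem eq_exponential (h : ProductInterpolation m D D b) (hD : 4 * m + 2 ≤ D) (h0 : b 0 ≠ 0)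
    {ν : ℕ} (hν : 1 ≤ ν) (hνm : ν ≤ m) (hlow : ∀ i, 1 ≤ i → i ≤ ν → b i = 0) (hbν : b (ν + 1) ≠ 0)
    {μ : ℂ} (hμ : μ ≠ 0) {S : Polynomial ℂ} (hS : S.natDegree ≤ m)
    (hb : ∀ j, 1 ≤ j → j ≤ D - 1 - ν → b j = S.eval (j : ℂ) * μ ^ j) :
    ∀ j ≤ D, b j = S.eval (j : ℂ) * μ ^ j := by
  have hS0 : b 0 = S.eval 0 := by
    by_contra hne
    have hS : S = 0 := by
      refine eq_zero_of_natDegree_lt_card_of_eval_natCast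
        (S := Finset.Icc 1 ν ∪ Finset.Icc (2 * m + 2) (D - 1 - ν)) ?_ ?_
      · rw [Finset.card_union_of_disjoint, Nat.card_Icc, Nat.card_Icc]
        · omega
        · rw [Finset.disjoint_left]
          intro i
          simp only [Finset.mem_Icc]
          omega
      · intro i hi
        rw [Finset.mem_union, Finset.mem_Icc, Finset.mem_Icc] at hi
        rcases hi with hi | hi
        · have := hb i hi.1 (by omega)
          rw [hlow i hi.1 hi.2] at this
          exact (mul_eq_zero.1 this.symm).resolve_right (pow_ne_zero _ hμ)
        · have h1 := h.apply_zero_mul_eq hS hi.1 (by omega) fun j hj hj' => hb j hj (by omega)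
          rw [hb i (by omega) hi.2, ← sub_eq_zero, ← sub_mul] at h1
          exact (mul_eq_zero.1 ((mul_eq_zero.1 h1).resolve_left
            (sub_ne_zero.2 hne))).resolve_right (pow_ne_zero _ hμ)
    refine hbν ?_
    rw [hb (ν + 1) (by omega) (by omega), hS]
    simp
  intro j
  induction j using Nat.strong_induction_on with
  | _ j ih =>
    intro hj
    rcases Nat.eq_zero_or_pos j with rfl | hj0
    · simpa using hS0
    by_cases hjL : j ≤ D - 1 - ν
    · exact hb j hj0 hjL
    have := h.apply_zero_mul_eq hS (show 2 * m + 2 ≤ j by omega) hj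
      fun l _ hl' => ih l hl' (by omega)
    rw [← hS0] at this
    exact mul_left_cancel₀ h0 this

theorem hasVanishingShear {v : ℕ} (h : ProductInterpolation m D D b) (hD : 4 * m + 2 ≤ D)
    (hlow : ∀ i < v, b i = 0) (hv : b v ≠ 0) (hvm : v ≤ m) : HasVanishingShear m (D - v) b := by
  induction m generalizing D b v with
  | zero =>
    obtain rfl : v = 0 := by omega
    refine .of_shear (c := -b 1 / b 0) (.of_eq_zero ?_)
    refine (h.shear (-b 1 / b 0)).eq_zero_of_initial_gap hD hv fun i h1 h2 => ?_
    obtain rfl : i = 1 := by omega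
    rw [shear_eq_sum]
    simp [Finset.sum_range_succ]
    field_simp
    ring
  | succ m ih =>
    obtain ⟨E, rfl⟩ : ∃ E, D = E + 4 := ⟨D - 4, by omega⟩
    rcases Nat.eq_zero_or_pos v with rfl | hvpos
    · set c := -b 1 / b 0 with hc
      have hb1 : shear c b 1 = 0 := by
        rw [shear_eq_sum]
        simp [Finset.sum_range_succ, hc]
        field_simp
        ring
      have hb0 : shear c b 0 ≠ 0 := hv
      have h' := h.shear c
      refine .of_shear (c := c) ?_
      generalize shear c b = β at hb1 hb0 h'
      by_cases hgap : ∀ i, 1 ≤ i → i ≤ m + 1 + 1 → β i = 0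
      · exact .of_eq_zero (h'.eq_zero_of_initial_gap hD hb0 hgap)
      classical
      have hex : ∃ n, β (n + 1) ≠ 0 := by
        push Not at hgap
        obtain ⟨i, hi, _, hi'⟩ := hgap
        exact ⟨i - 1, by rwa [Nat.sub_add_cancel hi]⟩
      obtain ⟨ν, hbν, hmin⟩ : ∃ ν, β (ν + 1) ≠ 0 ∧ ∀ i < ν, β (i + 1) = 0 :=
        ⟨Nat.find hex, Nat.find_spec hex, fun i hi => not_not.1 (Nat.find_min hex hi)⟩
      have hν : 1 ≤ ν := by
        by_contra hν
        obtain rfl : ν = 0 := by omega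
        exact hbν hb1
      have hνm : ν ≤ m + 1 := by
        by_contra hνm
        refine hgap fun i hi hi' => ?_
        have := hmin (i - 1) (by omega)
        rwa [Nat.sub_add_cancel hi] at this
      have hlow' : ∀ i, 1 ≤ i → i ≤ ν → β i = 0 := fun i hi hi' => by
        have := hmin (i - 1) (by omega)
        rwa [Nat.sub_add_cancel hi] at this
      have hshift : HasVanishingShear (m + 1) (E - (ν - 1) + 1) (fun i => β (i + 1)) := by
        refine .of_shift_div hb1 ?_
        refine ih (v := ν - 1) ((h'.shift (D := E + 2)).shift_div hb1) (by omega) ?_ ?_ (by omega)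
        · intro i hi
          simp [hmin (i + 1) (by omega)]
        · refine div_ne_zero ?_ (Nat.cast_add_one_ne_zero _)
          rwa [Nat.sub_add_cancel hν]
      rcases hshift.eq_zero_or_exponential with hz | ⟨μ, S, hμ, hS, hS'⟩
      · refine .of_eq_zero (h'.eq_zero_of_middle_gap hD hb0 fun i hi hi' => ?_)
        have := hz (i - 1) (by omega) (by omega)
        rwa [Nat.sub_add_cancel (by omega)] at this
      · have hdeg : (Polynomial.C μ⁻¹ * S.comp (Polynomial.X - Polynomial.C 1)).natDegree ≤ m + 1 := by
          refine (Polynomial.natDegree_C_mul_le _ _).trans ?_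
          rwa [Polynomial.natDegree_comp, Polynomial.natDegree_X_sub_C, mul_one]
        refine .of_exponential (μ := μ) hdeg fun i hi => ?_
        refine h'.eq_exponential hD hb0 hν hνm hlow' hbν hμ hdeg (fun j hj hj' => ?_) i (by omega)
        obtain ⟨j, rfl⟩ := Nat.exists_eq_add_of_le' hj
        rw [hS' j (by omega)]
        simp only [Polynomial.eval_mul, Polynomial.eval_C, Polynomial.eval_comp,
          Polynomial.eval_sub, Polynomial.eval_X]
        push_cast
        rw [add_sub_cancel_right, pow_succ]
        field_simp
    · have hb0 : b 0 = 0 := hlow 0 hvpos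
      have := ih (v := v - 1) ((h.mono le_rfl le_rfl).shift_div (D := E + 2) hb0) (by omega)
        (fun i hi => by simp [hlow (i + 1) (by omega)])
        (div_ne_zero (by rwa [Nat.sub_add_cancel hvpos]) (Nat.cast_add_one_ne_zero _)) (by omega)
      have := HasVanishingShear.of_shift_div hb0 this
      rwa [show E + 2 - (v - 1) + 1 = E + 4 - v by omega] at this

end ProductInterpolation

end VanishingShear

section Extraction

theorem exists_eq_binForm {d : ℕ} {f : MvPolynomial (Fin 2) ℂ} (hf : f.IsHomogeneous d) :
    ∃ a : ℕ → ℂ, f = binForm d a (X 0 : MvPolynomial (Fin 2) ℂ) (X 1) := by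
  have hmon : ∀ p q : ℕ, (X 0 ^ p * X 1 ^ q : MvPolynomial (Fin 2) ℂ) =
      monomial (Finsupp.single 0 p + Finsupp.single 1 q) 1 := fun p q => by
    rw [X_pow_eq_monomial, X_pow_eq_monomial, monomial_mul, one_mul]
  refine ⟨fun n => f.coeff (Finsupp.single 0 (d - n) + Finsupp.single 1 n) / (d.choose n : ℂ), ?_⟩
  ext s
  rw [binForm_eq_sum, coeff_sum]
  simp only [hmon, coeff_smul, coeff_monomial, smul_eq_mul, mul_ite, mul_one, mul_zero]
  by_cases hs : s 0 + s 1 = d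
  · have hs' : Finsupp.single 0 (d - s 1) + Finsupp.single 1 (s 1) = s := by
      ext i
      fin_cases i
      · simp
        omega
      · simp
    rw [Finset.sum_eq_single (s 1)]
    · rw [if_pos hs', hs', mul_div_cancel₀]
      exact Nat.cast_ne_zero.2 (Nat.choose_pos (by omega)).ne'
    · intro j _ hj
      rw [if_neg]
      rintro rfl
      simp at hj
    · intro h
      rw [Finset.mem_range] at h
      omega
  · rw [Finset.sum_eq_zero]
    · refine hf.coeff_eq_zero ?_
      rwa [Finsupp.degree_eq_sum, Fin.sum_univ_two]
    · intro j hj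
      rw [if_neg]
      rintro rfl
      rw [Finset.mem_range] at hj
      apply hs
      simp
      omega

theorem sum_neg_one_pow_mul_choose_mul_eval {n : ℕ} (hn : Even n) {P : Polynomial ℂ}
    (hP : P.natDegree = n) (t : ℂ) :
    ∑ i ∈ Finset.range (n + 1), (-1 : ℂ) ^ i * (n.choose i : ℂ) * P.eval (t + i) =
      P.leadingCoeff * (n.factorial : ℂ) := by
  have h := congrFun (Polynomial.fwdDiff_iter_degree_eq_factorial P) t
  rw [fwdDiff_iter_eq_sum_shift, hP] at h
  simp only [Pi.smul_apply, Pi.natCast_apply, smul_eq_mul] at h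
  rw [← h]
  refine Finset.sum_congr rfl fun i hi => ?_
  have hsign : (-1 : ℂ) ^ (n - i) = (-1) ^ i := by
    have h1 : (-1 : ℂ) ^ (n - i) * (-1) ^ i = 1 := by
      rw [← pow_add, Nat.sub_add_cancel (Nat.lt_succ_iff.1 (Finset.mem_range.1 hi)), hn.neg_one_pow]
    have h2 : (-1 : ℂ) ^ i * (-1) ^ i = 1 := by
      rw [← mul_pow]
      simp
    exact mul_right_cancel₀ (pow_ne_zero i (neg_ne_zero.2 one_ne_zero)) (h1.trans h2.symm)
  simp only [nsmul_eq_mul, mul_one, zsmul_eq_mul]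
  push_cast
  rw [hsign]

theorem even_natDegree_of_comp_C_sub_X {P : Polynomial ℂ} {c : ℂ}
    (h : P.comp (Polynomial.C c - Polynomial.X) = P) : Even P.natDegree := by
  rcases eq_or_ne P 0 with rfl | hP
  · simp
  have hX : Polynomial.C c - Polynomial.X = -(Polynomial.X - Polynomial.C c) := by ring
  have hlc := congrArg Polynomial.leadingCoeff h
  rw [Polynomial.leadingCoeff_comp, hX, Polynomial.leadingCoeff_neg,
    Polynomial.leadingCoeff_X_sub_C] at hlc
  · by_contra hodd
    rw [Nat.not_even_iff_odd] at hodd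
    rw [hodd.neg_one_pow, mul_neg_one, neg_eq_self] at hlc
    exact hP (Polynomial.leadingCoeff_eq_zero.1 hlc)
  · rw [hX, Polynomial.natDegree_neg, Polynomial.natDegree_X_sub_C]
    exact one_ne_zero

theorem productInterpolation_of_transv_eq_zero {d m : ℕ} {a : ℕ → ℂ}
    (h : ∀ j, m < j → j ≤ d / 2 → transv d d (2 * j)
      (binForm d a (X 0 : MvPolynomial (Fin 2) ℂ) (X 1)) (binForm d a (X 0) (X 1)) = 0) :
    ProductInterpolation m d (2 * d) a := by
  intro w hw
  set S := Finset.Icc (w - d) (min w d) with hS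
  have hinj : Set.InjOn (fun i : ℕ => (i : ℂ)) S := Nat.cast_injective.injOn
  set P := Lagrange.interpolate S (fun i : ℕ => (i : ℂ)) (fun i => a i * a (w - i)) with hPdef
  have heval : ∀ i j, i ≤ d → j ≤ d → i + j = w → P.eval (i : ℂ) = a i * a j := by
    intro i j hi hj hij
    have hmem : i ∈ S := by
      rw [hS, Finset.mem_Icc]
      omega
    rw [hPdef, Lagrange.eval_interpolate_at_node (fun i => a i * a (w - i)) hinj hmem,
      show w - i = j by omega]
  have hcard : S.card = min w d - (w - d) + 1 := by
    rw [hS, Nat.card_Icc]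
    omega
  have hdeg : P.natDegree < S.card := by
    rcases eq_or_ne P 0 with h0 | h0
    · rw [h0, Polynomial.natDegree_zero]
      omega
    · exact (Polynomial.natDegree_lt_iff_degree_lt h0).2 (Lagrange.degree_interpolate_lt _ hinj)
  refine ⟨P, ?_, heval⟩
  have hsymm : P.comp (Polynomial.C (w : ℂ) - Polynomial.X) = P := by
    rw [← sub_eq_zero]
    have hlin : (Polynomial.C (w : ℂ) - Polynomial.X).natDegree ≤ 1 :=
      (Polynomial.natDegree_sub_le _ _).trans (by simp)
    refine eq_zero_of_natDegree_lt_card_of_eval_natCast (S := S) ?_ fun i hi => ?_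
    · refine (Polynomial.natDegree_sub_le_of_le
        (Polynomial.natDegree_comp_le.trans (Nat.mul_le_mul_left _ hlin)) le_rfl).trans_lt ?_
      rwa [mul_one, max_self]
    · rw [hS, Finset.mem_Icc] at hi
      have h1 := heval i (w - i) (by omega) (by omega) (by omega)
      have h2 := heval (w - i) i (by omega) (by omega) (by omega)
      rw [Nat.cast_sub (by omega)] at h2
      simp only [Polynomial.eval_sub, Polynomial.eval_comp, Polynomial.eval_C, Polynomial.eval_X]
      rw [h1, h2]
      ring
  obtain ⟨j, hj⟩ := (even_natDegree_of_comp_C_sub_X hsymm).two_dvd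
  by_contra hlt
  have hzero := sum_eq_zero_of_transv_self_eq_zero (by omega) (h j (by omega) (by omega))
    (w - 2 * j)
  have hterm : ∀ x ∈ Finset.HasAntidiagonal.antidiagonal (w - 2 * j),
      ((d - 2 * j).choose x.1 : ℂ) * ((d - 2 * j).choose x.2 : ℂ) *
        ∑ i ∈ Finset.range (2 * j + 1),
          (-1 : ℂ) ^ i * ((2 * j).choose i : ℂ) * (a (x.1 + i) * a (x.2 + (2 * j - i))) =
      ((d - 2 * j).choose x.1 : ℂ) * ((d - 2 * j).choose x.2 : ℂ) *
        (P.leadingCoeff * ((2 * j).factorial : ℂ)) := by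
    intro x hx
    rw [Finset.HasAntidiagonal.mem_antidiagonal] at hx
    rcases lt_or_ge (d - 2 * j) x.1 with h1 | h1
    · simp [Nat.choose_eq_zero_of_lt h1]
    rcases lt_or_ge (d - 2 * j) x.2 with h2 | h2
    · simp [Nat.choose_eq_zero_of_lt h2]
    rw [← sum_neg_one_pow_mul_choose_mul_eval (even_two_mul j) hj (x.1 : ℂ)]
    congr 1
    refine Finset.sum_congr rfl fun i hi => ?_
    rw [Finset.mem_range] at hi
    rw [← heval (x.1 + i) (x.2 + (2 * j - i)) (by omega) (by omega) (by omega), Nat.cast_add]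
  rw [Finset.sum_congr rfl hterm, ← Finset.sum_mul] at hzero
  rw [sum_choose_mul_choose, mul_eq_zero, mul_eq_zero] at hzero
  rcases hzero with h1 | h1 | h1
  · exact (Nat.choose_pos (by omega)).ne' (Nat.cast_eq_zero.1 h1)
  · rw [Polynomial.leadingCoeff_eq_zero] at h1
    rw [h1, Polynomial.natDegree_zero] at hlt
    omega
  · exact Nat.factorial_ne_zero _ (Nat.cast_eq_zero.1 h1)

end Extraction

section Catalecticant

/-- The cubic invariant of the binary quartic with coefficients `a 0, …, a 4`. -/
def catalecticant (a : ℕ → ℂ) : ℂ :=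
  a 0 * a 2 * a 4 + 2 * a 1 * a 2 * a 3 - a 1 ^ 2 * a 4 - a 0 * a 3 ^ 2 - a 2 ^ 3

theorem catalecticant_reverse (a : ℕ → ℂ) : catalecticant (fun i => a (4 - i)) = catalecticant a := by
  simp only [catalecticant]
  norm_num
  ring

theorem catalecticant_shear (c : ℂ) (a : ℕ → ℂ) : catalecticant (shear c a) = catalecticant a := by
  simp only [catalecticant, shear_eq_sum, Finset.sum_range_succ, Finset.sum_range_zero]
  norm_num [Nat.choose]
  ring

theorem catalecticant_eq_zero_of_transv {a : ℕ → ℂ}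
    (h : transv 4 4 4 (transv 4 4 2 (binForm 4 a (X 0 : MvPolynomial (Fin 2) ℂ) (X 1))
      (binForm 4 a (X 0) (X 1))) (binForm 4 a (X 0) (X 1)) = 0) : catalecticant a = 0 := by
  let g : ℕ → ℂ := fun i => match i with
    | 0 => 2 * (a 0 * a 2 - a 1 ^ 2)
    | 1 => a 0 * a 3 - a 1 * a 2
    | 2 => (1 / 3) * (a 0 * a 4 + 2 * a 1 * a 3 - 3 * a 2 ^ 2)
    | 3 => a 1 * a 4 - a 2 * a 3
    | _ => 2 * (a 2 * a 4 - a 3 ^ 2)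
  have hg : transv 4 4 2 (binForm 4 a (X 0 : MvPolynomial (Fin 2) ℂ) (X 1))
      (binForm 4 a (X 0) (X 1)) = binForm 4 g (X 0) (X 1) := by
    have hthird : (C (1 / 3) : MvPolynomial (Fin 2) ℂ) * 3 = 1 := by
      rw [show (3 : MvPolynomial (Fin 2) ℂ) = C 3 from (map_ofNat C 3).symm, ← C_mul]
      norm_num
    rw [show transv 4 4 2 = transv (2 + 2) (2 + 2) 2 from rfl, transv_binForm 2 2 2 a a]
    simp only [Finset.sum_range_succ, Finset.sum_range_zero, binForm, g, algebraMap_eq, C_mul, C_add,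
      C_sub, C_pow, MvPolynomial.smul_eq_C_mul]
    norm_num [Nat.choose]
    simp only [map_ofNat]
    linear_combination (-2 * X 0 ^ 2 * X 1 ^ 2 *
      (C (a 0) * C (a 4) + 2 * C (a 1) * C (a 3) - 3 * C (a 2) ^ 2)) * hthird
  rw [hg, show transv 4 4 4 = transv (0 + 4) (0 + 4) 4 from rfl, transv_binForm 0 0 4 g a] at h
  simp only [binForm, algebraMap_eq, ← C_mul, MvPolynomial.smul_eq_C_mul, ← map_sum] at h
  rw [C_eq_zero] at h
  simp only [Finset.sum_range_succ, Finset.sum_range_zero, g] at h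
  norm_num [Nat.choose] at h
  rw [catalecticant]
  linear_combination h / 6

end Catalecticant

section RootMultiplicity

theorem pow_dvd_binForm_left {R : Type*} [CommRing R] [Algebra ℂ R] {n r : ℕ} {b : ℕ → ℂ}
    (h : ∀ i ≤ n, n < i + r → b i = 0) (x y : R) : x ^ r ∣ binForm n b x y := by
  rw [binForm_eq_sum]
  refine Finset.dvd_sum fun j hj => ?_
  have hj' : j ≤ n := Nat.lt_succ_iff.1 (Finset.mem_range.1 hj)
  rcases lt_or_ge n (j + r) with hjr | hjr
  · simp [h j hj' hjr]
  · rw [Algebra.smul_def]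
    exact ((pow_dvd_pow x (by omega)).mul_right _).mul_left _

theorem pow_dvd_binForm_right {R : Type*} [CommRing R] [Algebra ℂ R] {n r : ℕ} {b : ℕ → ℂ}
    (h : ∀ i < r, b i = 0) (x y : R) : y ^ r ∣ binForm n b x y := by
  rw [← binForm_reverse]
  exact pow_dvd_binForm_left (fun i _ hi' => h (n - i) (by omega)) y x

theorem hasVanishingShear_of_apply_zero {m : ℕ} (hm : 1 ≤ m) {b : ℕ → ℂ}
    (h : ProductInterpolation m (4 * m) (2 * (4 * m)) b) (hJ : m = 1 → catalecticant b = 0)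
    (hb : b 0 = 0) : (∀ i < 3 * m, b i = 0) ∨ HasVanishingShear m (4 * m) b := by
  classical
  by_cases hall : ∀ i < 3 * m, b i = 0
  · exact Or.inl hall
  right
  have hex : ∃ i, b i ≠ 0 := by
    push Not at hall
    obtain ⟨i, -, hi⟩ := hall
    exact ⟨i, hi⟩
  obtain ⟨e, hbe, hlow⟩ : ∃ e, b e ≠ 0 ∧ ∀ i < e, b i = 0 :=
    ⟨Nat.find hex, Nat.find_spec hex, fun i hi => not_not.1 (Nat.find_min hex hi)⟩
  have he3 : e < 3 * m := by
    by_contra he3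
    exact hall fun i hi => hlow i (by omega)
  have hem : e ≤ m := by
    by_contra hem
    refine hbe (mul_self_eq_zero.1 (h.mul_eq_zero (w := 2 * e) (by omega)
      ((Finset.Icc (2 * e - min (2 * e) (4 * m)) (min (2 * e) (4 * m))).erase e) ?_ ?_
      (by omega) (by omega) (by omega)))
    · rw [Finset.card_erase_of_mem (by rw [Finset.mem_Icc]; omega), Nat.card_Icc]
      omega
    · intro i hi
      rw [Finset.mem_erase, Finset.mem_Icc] at hi
      refine ⟨by omega, by omega, by omega, ?_⟩
      rcases lt_or_ge i e with h1 | h1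
      · exact Or.inl (hlow i h1)
      · exact Or.inr (hlow _ (by omega))
  have he0 : 0 < e := by
    rcases Nat.eq_zero_or_pos e with rfl | h0
    · exact absurd hb hbe
    · exact h0
  obtain ⟨n, rfl⟩ := Nat.exists_eq_add_of_le' hm
  obtain ⟨c, hc⟩ : HasVanishingShear (n + 1) (4 * n + 2 - (e - 1) + 1) b := by
    refine .of_shift_div hb (ProductInterpolation.hasVanishingShear
      ((h.mono (by omega) (by omega)).shift_div hb) le_rfl ?_ ?_ (by omega))
    · intro i hi
      simp [hlow (i + 1) (by omega)]
    · exact div_ne_zero (by rwa [Nat.sub_add_cancel he0]) (Nat.cast_add_one_ne_zero _)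
  refine ⟨c, ?_⟩
  have h' := h.shear c
  have hlow' := shear_eq_zero hlow c
  have hbe' : shear c b e ≠ 0 := by rwa [shear_apply_order hlow]
  have hJ' : n + 1 = 1 → catalecticant (shear c b) = 0 := by rwa [catalecticant_shear]
  generalize shear c b = β at hc h' hlow' hbe' hJ'
  by_contra hne
  have hex' : ∃ i, n + 1 < i ∧ i ≤ 4 * (n + 1) ∧ β i ≠ 0 := by
    push Not at hne
    exact hne
  obtain ⟨p, ⟨hp1, hp2, hp3⟩, hpmin⟩ : ∃ p, (n + 1 < p ∧ p ≤ 4 * (n + 1) ∧ β p ≠ 0) ∧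
      ∀ i < p, ¬ (n + 1 < i ∧ i ≤ 4 * (n + 1) ∧ β i ≠ 0) :=
    ⟨Nat.find hex', Nat.find_spec hex', fun i hi => Nat.find_min hex' hi⟩
  obtain ⟨l, hl1, hl2, hlmax⟩ : ∃ l, l ≤ n + 1 ∧ β l ≠ 0 ∧ ∀ i, l < i → i ≤ n + 1 → β i = 0 :=
    ⟨Nat.findGreatest (fun i => β i ≠ 0) (n + 1), Nat.findGreatest_le _,
      Nat.findGreatest_spec (P := fun i => β i ≠ 0) hem hbe',
      fun i hi hi' => not_not.1 (Nat.findGreatest_is_greatest hi hi')⟩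
  have hgap : ∀ i, l < i → i < p → β i = 0 := by
    intro i hi hip
    rcases le_or_gt i (n + 1) with h1 | h1
    · exact hlmax i hi h1
    · by_contra h2
      exact hpmin i hip ⟨h1, by omega, h2⟩
  have hel : e ≤ l := by
    by_contra hel
    exact hl2 (hlow' l (by omega))
  have hpe : 4 * (n + 1) - e < p := by
    by_contra hpe
    exact hp3 (hc p hp1 (by omega))
  refine mul_ne_zero hl2 hp3 ?_
  by_cases hwide : 2 * (n + 1) < p - l - 1
  · refine h'.mul_eq_zero (w := l + p) (by omega) (Finset.Ioo l p) (by rwa [Nat.card_Ioo]) ?_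
      (by omega) (by omega) rfl
    intro i hi
    rw [Finset.mem_Ioo] at hi
    exact ⟨by omega, by omega, by omega, Or.inl (hgap i hi.1 hi.2)⟩
  obtain rfl : l = n + 1 := by omega
  obtain rfl : e = n + 1 := by omega
  obtain rfl : p = 3 * (n + 1) + 1 := by omega
  rcases Nat.eq_zero_or_pos n with rfl | hn
  · have hJ0 := hJ' rfl
    have h2 := hgap 2 (by omega) (by omega)
    have h3 := hgap 3 (by omega) (by omega)
    have h0 := hlow' 0 (by omega)
    rw [catalecticant, h0, h2, h3] at hJ0
    have h14 : β 1 ^ 2 * β 4 = 0 := by linear_combination -hJ0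
    rcases mul_eq_zero.1 h14 with h1 | h1
    · exact absurd (pow_eq_zero_iff two_ne_zero |>.1 h1) hl2
    · exact absurd h1 hp3
  · refine h'.mul_eq_zero (w := n + 1 + (3 * (n + 1) + 1)) (by omega)
      (insert n (Finset.Ioo (n + 1) (3 * (n + 1) + 1))) ?_ ?_ (by omega) (by omega) rfl
    · rw [Finset.card_insert_of_notMem (by simp), Nat.card_Ioo]
      omega
    · intro i hi
      rw [Finset.mem_insert, Finset.mem_Ioo] at hi
      rcases hi with rfl | hi
      · exact ⟨by omega, by omega, by omega, Or.inl (hlow' i (by omega))⟩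
      · exact ⟨by omega, by omega, by omega, Or.inl (hgap i hi.1 hi.2)⟩

theorem hasRootOfMult_binForm {m : ℕ} (hm : 1 ≤ m) {a : ℕ → ℂ}
    (h : ProductInterpolation m (4 * m) (2 * (4 * m)) a) (hJ : m = 1 → catalecticant a = 0) :
    HasRootOfMult (3 * m) (binForm (4 * m) a (X 0 : MvPolynomial (Fin 2) ℂ) (X 1)) := by
  set p : Polynomial ℂ := binForm (4 * m) a 1 Polynomial.X with hp
  by_cases hdeg : p.degree = 0 ∨ p = 0
  · have hz : ∀ i, 1 ≤ i → i ≤ 4 * m → a i = 0 := by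
      intro i hi hi'
      have hc : p.coeff i = 0 := by
        rcases hdeg with h0 | h0
        · exact Polynomial.coeff_eq_zero_of_degree_lt (by rw [h0]; exact_mod_cast hi)
        · rw [h0, Polynomial.coeff_zero]
      rw [hp, coeff_binForm] at hc
      exact (mul_eq_zero.1 hc).resolve_left (Nat.cast_ne_zero.2 (Nat.choose_pos hi').ne')
    refine ⟨1, 0, Or.inl one_ne_zero, ?_⟩
    rw [C_1, C_0, one_mul, zero_mul, add_zero]
    exact pow_dvd_binForm_left (fun i hi hi' => hz i (by omega) hi) _ _
  obtain ⟨c, hc⟩ := IsAlgClosed.exists_root p fun h0 => hdeg (Or.inl h0)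
  have hc' : shear c (fun i => a (4 * m - i)) (4 * m) = 0 := by
    change binForm (4 * m) (fun i => a (4 * m - i)) c 1 = 0
    rw [binForm_reverse]
    have := map_binForm (Polynomial.aeval c) (4 * m) a (1 : Polynomial ℂ) Polynomial.X
    rw [map_one, Polynomial.aeval_X, ← hp, Polynomial.aeval_def] at this
    rw [← this]
    exact hc
  set b : ℕ → ℂ := fun i => shear c (fun i => a (4 * m - i)) (4 * m - i) with hb
  have hform : binForm (4 * m) a (X 0 : MvPolynomial (Fin 2) ℂ) (X 1) =
      binForm (4 * m) b (X 0) (X 1 - c • X 0) := by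
    rw [hb, binForm_reverse, binForm_shear, sub_add_cancel, binForm_reverse]
  have hJb : m = 1 → catalecticant b = 0 := by
    rintro rfl
    rw [hb]
    simp only [mul_one]
    rw [catalecticant_reverse, catalecticant_shear, catalecticant_reverse]
    exact hJ rfl
  rw [hform]
  rcases hasVanishingShear_of_apply_zero hm (h.reverse.shear c).reverse hJb hc' with h0 | ⟨e, he⟩
  · refine ⟨-c, 1, Or.inr one_ne_zero, ?_⟩
    convert pow_dvd_binForm_right h0 (X 0 : MvPolynomial (Fin 2) ℂ) (X 1 - c • X 0) using 2
    rw [MvPolynomial.smul_eq_C_mul, C_neg, C_1]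
    ring
  · have hb' : b = shear (-e) (shear e b) := by rw [shear_shear, neg_add_cancel, shear_by_zero]
    rw [hb', binForm_shear]
    refine ⟨1 + e * c, -e, ?_, ?_⟩
    · by_cases he0 : e = 0
      · simp [he0]
      · exact Or.inr (neg_ne_zero.2 he0)
    · have hlin : C (1 + e * c) * X 0 + C (-e) * X 1 =
          (X 0 : MvPolynomial (Fin 2) ℂ) + -e • (X 1 - c • X 0) := by
        simp only [MvPolynomial.smul_eq_C_mul, C_add, C_mul, C_1, C_neg]
        ring
      rw [hlin]
      exact pow_dvd_binForm_left (fun i hi hi' => he i (by omega) hi) _ _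

end RootMultiplicity

/-- (Weyman) Let `f ∈ V_d` and `k ≥ 1` with `d = 4k − 4`. If the transvectant
`((f,f)_{2k−2}, f)_d` vanishes and the transvectants `(f,f)_{2j}` vanish for all `j`
with `k ≤ j ≤ ⌊d/2⌋`, then `f` has a root of multiplicity at least `d − k + 1`. -/
theorem weyman_boundary (d k : ℕ) (hk : 1 ≤ k) (hd : d = 4 * k - 4)
    (f : MvPolynomial (Fin 2) ℂ) (hf : f.IsHomogeneous d)
    (hvan0 : transv d d d (transv d d (2 * k - 2) f f) f = 0)
    (hvan : ∀ j : ℕ, k ≤ j → j ≤ d / 2 → transv d d (2 * j) f f = 0) :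
    HasRootOfMult (d - k + 1) f := by
  obtain ⟨m, rfl⟩ := Nat.exists_eq_add_of_le' hk
  obtain rfl : d = 4 * m := by omega
  rcases Nat.eq_zero_or_pos m with rfl | hm
  · have hf0 : f = 0 := by simpa [transv] using hvan0
    exact ⟨1, 0, Or.inl one_ne_zero, hf0 ▸ dvd_zero _⟩
  obtain ⟨a, rfl⟩ := exists_eq_binForm hf
  rw [show 4 * m - (m + 1) + 1 = 3 * m by omega]
  refine hasRootOfMult_binForm hm (productInterpolation_of_transv_eq_zero fun j hj => hvan j hj) ?_
  rintro rfl
  exact catalecticant_eq_zero_of_transv hvan0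
end

section
/- Let f ∈ V_10 and set j_2 = (f,f)_10, k = (f,f)_8 ∈ V_4, m = (f,k)_4 ∈ V_6. If j_2 = 0, k ≠ 0, and there exists a nonzero linear form ℓ with ℓ^3 dividing k and ℓ^4 dividing m (i.e., (k,m) lies in the nullcone of V_4 ⊕ V_6), then f has a root of multiplicity at least 6. -/
open MvPolynomial

namespace BinaryForm

open TensorProduct

/-- Cayley's `Ω`-process on pairs of polynomials in two variables. -/
noncomputable def cayleyOmega : Module.End ℂ (MvPolynomial (Fin 2) ℂ ⊗[ℂ] MvPolynomial (Fin 2) ℂ) :=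
  (-1 : ℂ) • TensorProduct.map (pderiv 1).toLinearMap (pderiv 0).toLinearMap +
    TensorProduct.map (pderiv 0).toLinearMap (pderiv 1).toLinearMap

theorem pderiv_zero_one_comm :
    Commute ((pderiv (R := ℂ) (0 : Fin 2)).toLinearMap : Module.End ℂ (MvPolynomial (Fin 2) ℂ))
      (pderiv (1 : Fin 2)).toLinearMap := by
  refine LinearMap.ext fun p => ?_
  induction p using MvPolynomial.induction_on' with
  | monomial u a =>
    simp only [Module.End.mul_apply, Derivation.coeFn_coe,
      pderiv_monomial]
    congr 1
    · rw [tsub_right_comm]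
    · simp
      ring
  | add p q hp hq => rw [map_add, map_add, hp, hq]

theorem transv_eq_cayleyOmega (n m k : ℕ) (f g : MvPolynomial (Fin 2) ℂ) :
    transv n m k f g =
      ((((n - k).factorial * (m - k).factorial : ℕ) : ℂ) /
        ((n.factorial * m.factorial : ℕ) : ℂ)) •
      LinearMap.mul' ℂ _ ((cayleyOmega ^ k) (f ⊗ₜ g)) := by
  have hc : Commute
      (TensorProduct.map (pderiv (R := ℂ) (1 : Fin 2)).toLinearMap
        (pderiv (R := ℂ) (0 : Fin 2)).toLinearMap)
      (TensorProduct.map (pderiv (R := ℂ) (0 : Fin 2)).toLinearMap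
        (pderiv (R := ℂ) (1 : Fin 2)).toLinearMap) := by
    rw [Commute, SemiconjBy, ← TensorProduct.map_mul, ← TensorProduct.map_mul,
      pderiv_zero_one_comm.eq]
  rw [transv, cayleyOmega, (hc.smul_left (-1 : ℂ)).add_pow,
    LinearMap.sum_apply, map_sum]
  refine congrArg _ (Finset.sum_congr rfl fun i _ => ?_)
  rw [smul_pow, TensorProduct.map_pow, TensorProduct.map_pow, smul_mul_assoc, smul_mul_assoc,
    ← nsmul_eq_mul' (TensorProduct.map _ _ * TensorProduct.map _ _),
    ← Nat.cast_smul_eq_nsmul ℂ, smul_smul, LinearMap.smul_apply,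
    Module.End.mul_apply, TensorProduct.map_tmul, TensorProduct.map_tmul, map_smul,
    LinearMap.mul'_apply, ← Module.End.mul_apply,
    ← (pderiv_zero_one_comm.pow_pow (k - i) i).eq, Module.End.mul_apply]
  simp only [Module.End.pow_apply]
  rfl

/-- The linear substitution `x ↦ ax + by`, `y ↦ cx + dy`. -/
noncomputable def linSubst (a b c d : ℂ) : MvPolynomial (Fin 2) ℂ →ₐ[ℂ] MvPolynomial (Fin 2) ℂ :=
  aeval ![C a * X 0 + C b * X 1, C c * X 0 + C d * X 1]

theorem pderiv_zero_linSubst (a b c d : ℂ) (p : MvPolynomial (Fin 2) ℂ) :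
    pderiv 0 (linSubst a b c d p) =
      a • linSubst a b c d (pderiv 0 p) + c • linSubst a b c d (pderiv 1 p) := by
  induction p using MvPolynomial.induction_on with
  | C r => simp [linSubst]
  | add p q hp hq => simp only [map_add, hp, hq, smul_add]; abel
  | mul_X p i hp =>
    rw [map_mul, Derivation.leibniz, hp]
    fin_cases i <;> simp [linSubst, Derivation.leibniz, MvPolynomial.smul_eq_C_mul, pderiv_X] <;> ring

theorem pderiv_one_linSubst (a b c d : ℂ) (p : MvPolynomial (Fin 2) ℂ) :
    pderiv 1 (linSubst a b c d p) =
      b • linSubst a b c d (pderiv 0 p) + d • linSubst a b c d (pderiv 1 p) := by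
  induction p using MvPolynomial.induction_on with
  | C r => simp [linSubst]
  | add p q hp hq => simp only [map_add, hp, hq, smul_add]; abel
  | mul_X p i hp =>
    rw [map_mul, Derivation.leibniz, hp]
    fin_cases i <;> simp [linSubst, Derivation.leibniz, MvPolynomial.smul_eq_C_mul, pderiv_X] <;> ring

theorem cayleyOmega_linSubst {a b c d : ℂ} (h : a * d - b * c = 1)
    (t : MvPolynomial (Fin 2) ℂ ⊗[ℂ] MvPolynomial (Fin 2) ℂ) :
    cayleyOmega (TensorProduct.map (linSubst a b c d).toLinearMap
        (linSubst a b c d).toLinearMap t) =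
      TensorProduct.map (linSubst a b c d).toLinearMap (linSubst a b c d).toLinearMap
        (cayleyOmega t) := by
  induction t with
  | zero => simp
  | add s t hs ht => simp only [map_add, hs, ht]
  | tmul f g =>
    simp only [cayleyOmega, LinearMap.add_apply, LinearMap.smul_apply, TensorProduct.map_tmul, map_add, map_smul,
      AlgHom.toLinearMap_apply, Derivation.coeFn_coe,
      pderiv_zero_linSubst, pderiv_one_linSubst, TensorProduct.add_tmul, TensorProduct.tmul_add,
      TensorProduct.smul_tmul_smul]
    linear_combination (norm := module) h • (linSubst a b c d (pderiv 0 f) ⊗ₜ[ℂ] linSubst a b c d (pderiv 1 g)) -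
      h • (linSubst a b c d (pderiv 1 f) ⊗ₜ[ℂ] linSubst a b c d (pderiv 0 g))

theorem transv_linSubst {a b c d : ℂ} (h : a * d - b * c = 1) (n m k : ℕ)
    (f g : MvPolynomial (Fin 2) ℂ) :
    transv n m k (linSubst a b c d f) (linSubst a b c d g) =
      linSubst a b c d (transv n m k f g) := by
  rw [transv_eq_cayleyOmega, transv_eq_cayleyOmega, map_smul]
  congr 1
  have hpow : ∀ t, (cayleyOmega ^ k) (TensorProduct.map (linSubst a b c d).toLinearMap
        (linSubst a b c d).toLinearMap t) =
      TensorProduct.map (linSubst a b c d).toLinearMap (linSubst a b c d).toLinearMap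
        ((cayleyOmega ^ k) t) := by
    induction k with
    | zero => simp
    | succ k ih => intro t; rw [pow_succ, Module.End.mul_apply, cayleyOmega_linSubst h, ih]; rfl
  have hmul : ∀ t, LinearMap.mul' ℂ _ (TensorProduct.map (linSubst a b c d).toLinearMap
        (linSubst a b c d).toLinearMap t) = linSubst a b c d (LinearMap.mul' ℂ _ t) := by
    intro t
    induction t with
    | zero => simp
    | add s t hs ht => simp only [map_add, hs, ht]
    | tmul f g => simp
  rw [← hmul, ← hpow]
  simp

theorem linSubst_comp_inverse {a b c d : ℂ} (h : a * d - b * c = 1)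
    (f : MvPolynomial (Fin 2) ℂ) :
    linSubst a b c d (linSubst d (-b) (-c) a f) = f := by
  have hC : (C a * C d - C b * C c : MvPolynomial (Fin 2) ℂ) = 1 := by
    rw [← C_mul, ← C_mul, ← C_sub, h, C_1]
  have : (linSubst a b c d).comp (linSubst d (-b) (-c) a) = AlgHom.id ℂ _ := by
    refine MvPolynomial.algHom_ext fun i => ?_
    fin_cases i
    · simp [linSubst, MvPolynomial.algebraMap_eq]
      linear_combination (X 0) * hC
    · simp [linSubst, MvPolynomial.algebraMap_eq]
      linear_combination (X 1) * hC
  exact DFunLike.congr_fun this f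

theorem isHomogeneous_linSubst (a b c d : ℂ) {n : ℕ} {f : MvPolynomial (Fin 2) ℂ}
    (hf : f.IsHomogeneous n) : (linSubst a b c d f).IsHomogeneous n := by
  have := hf.aeval (n := 1) (τ := Fin 2) ![C a * X 0 + C b * X 1, C c * X 0 + C d * X 1] (fun i => by
    fin_cases i <;> exact ((isHomogeneous_X _ _).C_mul _).add ((isHomogeneous_X _ _).C_mul _))
  rw [one_mul] at this
  rw [linSubst]
  exact this

/-- The binary form `∑ binom(n,i) aᵢ x^(n-i) y^i`. -/
noncomputable def form (n : ℕ) (a : ℕ → ℂ) : MvPolynomial (Fin 2) ℂ :=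
  ∑ i ∈ Finset.range (n + 1), C ((n.choose i : ℂ) * a i) * X 0 ^ (n - i) * X 1 ^ i

theorem exists_eq_form {n : ℕ} {f : MvPolynomial (Fin 2) ℂ} (hf : f.IsHomogeneous n) :
    ∃ a, f = form n a := by
  refine ⟨fun i => (n.choose i : ℂ)⁻¹ *
    coeff (Finsupp.single 0 (n - i) + Finsupp.single 1 i) f, ?_⟩
  have key : ∀ i : ℕ, (C 1 * X 0 ^ (n - i) * X 1 ^ i : MvPolynomial (Fin 2) ℂ) =
      monomial (Finsupp.single 0 (n - i) + Finsupp.single 1 i) 1 := by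
    intro i
    rw [X_pow_eq_monomial, X_pow_eq_monomial, C_1, one_mul, monomial_mul, one_mul]
  ext d
  rw [form, coeff_sum]
  have hterm : ∀ i ∈ Finset.range (n + 1), coeff d (C ((n.choose i : ℂ) * ((n.choose i : ℂ)⁻¹ *
      coeff (Finsupp.single 0 (n - i) + Finsupp.single 1 i) f)) * X 0 ^ (n - i) * X 1 ^ i) =
      if Finsupp.single 0 (n - i) + Finsupp.single 1 i = d then coeff d f else 0 := by
    intro i hi
    have hne : (n.choose i : ℂ) ≠ 0 :=
      Nat.cast_ne_zero.2 (Nat.choose_pos (Nat.lt_succ_iff.1 (Finset.mem_range.1 hi))).ne'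
    have := key i
    rw [C_1, one_mul] at this
    rw [mul_assoc, this, coeff_C_mul, coeff_monomial, mul_inv_cancel_left₀ hne]
    split_ifs with h
    · rw [h, mul_one]
    · rw [mul_zero]
  rw [Finset.sum_congr rfl hterm]
  by_cases hd : coeff d f = 0
  · simp [hd]
  have hdeg : d 0 + d 1 = n := by
    have := hf hd
    rw [Finsupp.weight_apply, Finsupp.sum_fintype _ _ (by simp)] at this
    simpa using this
  rw [Finset.sum_eq_single (d 1)]
  · rw [if_pos]
    ext j
    fin_cases j <;> simp
    omega
  · intro i _ hi
    rw [if_neg]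
    rintro rfl
    simp at hi
  · intro h
    simp at h
    omega

theorem X_pow_dvd_form {r n : ℕ} {a : ℕ → ℂ} (h : ∀ i, i ≤ n → n < i + r → a i = 0) :
    X 0 ^ r ∣ form n a := by
  refine Finset.dvd_sum fun i hi => ?_
  by_cases hir : n < i + r
  · simp [h i (Nat.lt_succ_iff.1 (Finset.mem_range.1 hi)) hir]
  · exact Dvd.dvd.mul_right (Dvd.dvd.mul_left (pow_dvd_pow _ (by omega)) _) _

theorem eq_zero_of_X_pow_dvd_form {r n : ℕ} {a : ℕ → ℂ} (h : X 0 ^ r ∣ form n a) (i : ℕ)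
    (hin : i ≤ n) (hi : n < i + r) : a i = 0 := by
  have h' := map_dvd (aeval (R := ℂ) ![(Polynomial.X : Polynomial ℂ), 1]) h
  simp only [form, map_pow, map_sum, map_mul, aeval_X, Matrix.cons_val_zero, Matrix.cons_val_one,
    one_pow, mul_one, aeval_C, Polynomial.algebraMap_eq] at h'
  have h0 := Polynomial.X_pow_dvd_iff.1 h' (n - i) (by omega)
  rw [Polynomial.finsetSum_coeff, Finset.sum_eq_single i] at h0
  · rw [← Polynomial.C_mul, Polynomial.coeff_C_mul, Polynomial.coeff_X_pow_self, mul_one] at h0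
    exact (mul_eq_zero.1 h0).resolve_left (Nat.cast_ne_zero.2 (Nat.choose_pos hin).ne')
  · intro j hj hji
    have := Finset.mem_range.1 hj
    rw [← Polynomial.C_mul, Polynomial.coeff_C_mul, Polynomial.coeff_X_pow, if_neg (by omega),
      mul_zero]
  · intro hni
    exact absurd (Finset.mem_range.2 (by omega)) hni

theorem pderiv_zero_term (r : ℂ) (k l : ℕ) :
    pderiv 0 (C r * X 0 ^ k * X 1 ^ l : MvPolynomial (Fin 2) ℂ) =
      C (r * k) * X 0 ^ (k - 1) * X 1 ^ l := by
  simp [Derivation.leibniz, Derivation.leibniz_pow, pderiv_X]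
  ring

theorem pderiv_one_term (r : ℂ) (k l : ℕ) :
    pderiv 1 (C r * X 0 ^ k * X 1 ^ l : MvPolynomial (Fin 2) ℂ) =
      C (r * l) * X 0 ^ k * X 1 ^ (l - 1) := by
  simp [Derivation.leibniz, Derivation.leibniz_pow, pderiv_X]
  ring

theorem pderiv_zero_form (n : ℕ) (a : ℕ → ℂ) :
    pderiv 0 (form (n + 1) a) = ((n + 1 : ℕ) : ℂ) • form n a := by
  simp only [form, map_sum, pderiv_zero_term, Finset.smul_sum]
  rw [Finset.sum_range_succ, Nat.sub_self, Nat.cast_zero, mul_zero, C_0, zero_mul, zero_mul,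
    add_zero]
  refine Finset.sum_congr rfl fun i hi => ?_
  have hch : ((n + 1 : ℕ) : ℂ) * n.choose i = (n + 1).choose i * ((n + 1 - i : ℕ) : ℂ) := by
    rw [← Nat.cast_mul, ← Nat.cast_mul, mul_comm, Nat.choose_mul_succ_eq]
  rw [smul_eq_C_mul, ← mul_assoc, ← mul_assoc, ← C_mul, ← mul_assoc, hch,
    show n + 1 - i - 1 = n - i by omega, mul_right_comm (_ : ℂ)]

theorem pderiv_one_form (n : ℕ) (a : ℕ → ℂ) :
    pderiv 1 (form (n + 1) a) = ((n + 1 : ℕ) : ℂ) • form n (fun i => a (i + 1)) := by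
  simp only [form, map_sum, pderiv_one_term, Finset.smul_sum]
  rw [Finset.sum_range_succ', Nat.cast_zero, mul_zero, C_0, zero_mul, zero_mul, add_zero]
  refine Finset.sum_congr rfl fun i hi => ?_
  have hch : ((n + 1 : ℕ) : ℂ) * n.choose i = (n + 1).choose (i + 1) * ((i + 1 : ℕ) : ℂ) := by
    rw [← Nat.cast_mul, ← Nat.cast_mul, Nat.add_one_mul_choose_eq]
  rw [smul_eq_C_mul, ← mul_assoc, ← mul_assoc, ← C_mul, ← mul_assoc, hch,
    Nat.add_sub_add_right, Nat.add_sub_cancel, mul_right_comm (_ : ℂ)]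

theorem iterate_pderiv_smul (j : Fin 2) (k : ℕ) (r : ℂ) (f : MvPolynomial (Fin 2) ℂ) :
    (fun p => pderiv j p)^[k] (r • f) = r • (fun p => pderiv j p)^[k] f := by
  induction k generalizing f with
  | zero => rfl
  | succ k ih => rw [Function.iterate_succ_apply, Function.iterate_succ_apply, Derivation.map_smul, ih]

theorem iterate_pderiv_zero_form (k n : ℕ) (a : ℕ → ℂ) :
    (fun p => pderiv (0 : Fin 2) p)^[k] (form (n + k) a) =
      (((n + k).factorial : ℂ) / (n.factorial : ℂ)) • form n a := by
  have hn : (n.factorial : ℂ) ≠ 0 := Nat.cast_ne_zero.2 n.factorial_ne_zero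
  induction k with
  | zero => simp [div_self hn]
  | succ k ih =>
    rw [Function.iterate_succ_apply, ← add_assoc, pderiv_zero_form, iterate_pderiv_smul, ih,
      smul_smul, Nat.factorial_succ, Nat.cast_mul, mul_div_assoc]

theorem iterate_pderiv_one_form (k n : ℕ) (a : ℕ → ℂ) :
    (fun p => pderiv (1 : Fin 2) p)^[k] (form (n + k) a) =
      (((n + k).factorial : ℂ) / (n.factorial : ℂ)) • form n (fun i => a (i + k)) := by
  have hn : (n.factorial : ℂ) ≠ 0 := Nat.cast_ne_zero.2 n.factorial_ne_zero
  induction k generalizing a with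
  | zero => simp [div_self hn]
  | succ k ih =>
    rw [Function.iterate_succ_apply, ← add_assoc, pderiv_one_form, iterate_pderiv_smul, ih,
      smul_smul, Nat.factorial_succ, Nat.cast_mul, mul_div_assoc]
    simp only [add_assoc]

theorem iterate_pderiv_form (n i j : ℕ) (a : ℕ → ℂ) :
    (fun p => pderiv (0 : Fin 2) p)^[i] ((fun p => pderiv (1 : Fin 2) p)^[j]
      (form (n + i + j) a)) =
      (((n + i + j).factorial : ℂ) / (n.factorial : ℂ)) • form n (fun l => a (l + j)) := by
  rw [iterate_pderiv_one_form, iterate_pderiv_smul, iterate_pderiv_zero_form, smul_smul,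
    div_mul_div_cancel₀ (Nat.cast_ne_zero.2 (Nat.factorial_ne_zero _))]

theorem transv_form (p q k : ℕ) (a b : ℕ → ℂ) :
    transv (p + k) (q + k) k (form (p + k) a) (form (q + k) b) =
      ∑ i ∈ Finset.range (k + 1), ((-1 : ℂ) ^ i * (k.choose i : ℂ)) •
        (form p (fun l => a (l + i)) * form q (fun l => b (l + (k - i)))) := by
  rw [transv, Finset.smul_sum]
  refine Finset.sum_congr rfl fun i hi => ?_
  have hi' : i ≤ k := Nat.lt_succ_iff.1 (Finset.mem_range.1 hi)
  have ha := iterate_pderiv_form p (k - i) i a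
  have hb := iterate_pderiv_form q i (k - i) b
  rw [show p + (k - i) + i = p + k by omega] at ha
  rw [show q + i + (k - i) = q + k by omega] at hb
  have := Nat.factorial_ne_zero p
  have := Nat.factorial_ne_zero q
  have := Nat.factorial_ne_zero (p + k)
  have := Nat.factorial_ne_zero (q + k)
  rw [ha, hb, smul_mul_smul_comm, smul_smul, smul_smul, Nat.add_sub_cancel, Nat.add_sub_cancel]
  congr 1
  push_cast
  field_simp

/-- The coefficients of the quartic covariant `(f, f)₈` of a binary form `f` of degree ten. -/
noncomputable def quarticCoeff (a : ℕ → ℂ) : ℕ → ℂ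
  | 0 => 2 * a 0 * a 8 - 16 * a 1 * a 7 + 56 * a 2 * a 6 - 112 * a 3 * a 5 + 70 * a 4 ^ 2
  | 1 => a 0 * a 9 - 7 * a 1 * a 8 + 20 * a 2 * a 7 - 28 * a 3 * a 6 + 14 * a 4 * a 5
  | 2 => (a 0 * a 10 - 4 * a 1 * a 9 - 3 * a 2 * a 8 + 48 * a 3 * a 7 - 126 * a 4 * a 6
      + 84 * a 5 ^ 2) / 3
  | 3 => a 1 * a 10 - 7 * a 2 * a 9 + 20 * a 3 * a 8 - 28 * a 4 * a 7 + 14 * a 5 * a 6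
  | 4 => 2 * a 2 * a 10 - 16 * a 3 * a 9 + 56 * a 4 * a 8 - 112 * a 5 * a 7 + 70 * a 6 ^ 2
  | _ => 0

theorem transv_ten_eight_form (a : ℕ → ℂ) :
    transv 10 10 8 (form 10 a) (form 10 a) = form 4 (quarticCoeff a) := by
  have h3 : (C (σ := Fin 2) (3 : ℂ)⁻¹) * 3 = 1 := by
    rw [← map_ofNat C 3, ← C_mul, inv_mul_cancel₀ three_ne_zero, C_1]
  rw [transv_form 2 2 8]
  simp [Finset.sum_range_succ, form, smul_eq_C_mul, Nat.choose, quarticCoeff, map_ofNat C,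
    div_eq_mul_inv]
  linear_combination (-2 * X 0 ^ 2 * X 1 ^ 2 * (C (a 0) * C (a 10) - 4 * C (a 1) * C (a 9)
    - 3 * C (a 2) * C (a 8) + 48 * C (a 3) * C (a 7) - 126 * C (a 4) * C (a 6)
    + 84 * C (a 5) ^ 2)) * h3

theorem transv_ten_ten_form (a : ℕ → ℂ) :
    transv 10 10 10 (form 10 a) (form 10 a) = C (2 * a 0 * a 10 - 20 * a 1 * a 9 + 90 * a 2 * a 8
      - 240 * a 3 * a 7 + 420 * a 4 * a 6 - 252 * a 5 ^ 2) := by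
  rw [transv_form 0 0 10]
  simp [Finset.sum_range_succ, form, smul_eq_C_mul, Nat.choose, map_ofNat C]
  ring

theorem transv_ten_four_form (a κ : ℕ → ℂ) :
    transv 10 4 4 (form 10 a) (form 4 κ) = form 6 fun i => κ 4 * a i - 4 * κ 3 * a (i + 1)
      + 6 * κ 2 * a (i + 2) - 4 * κ 1 * a (i + 3) + κ 0 * a (i + 4) := by
  rw [transv_form 6 0 4]
  simp [Finset.sum_range_succ, form, smul_eq_C_mul, Nat.choose, map_ofNat C]
  ring

theorem X_pow_six_dvd_of_quarticCoeff {a : ℕ → ℂ}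
    (hne : quarticCoeff a 0 ≠ 0 ∨ quarticCoeff a 1 ≠ 0)
    (hdeg : quarticCoeff a 0 = 0 ∨ quarticCoeff a 1 = 0)
    (hj2 : transv 10 10 10 (form 10 a) (form 10 a) = 0)
    (hk : X 0 ^ 3 ∣ form 4 (quarticCoeff a))
    (hm : X 0 ^ 4 ∣ transv 10 4 4 (form 10 a) (form 4 (quarticCoeff a))) :
    X 0 ^ 6 ∣ form 10 a := by
  have k2 := eq_zero_of_X_pow_dvd_form hk 2 (by simp) (by simp)
  have k3 := eq_zero_of_X_pow_dvd_form hk 3 (by simp) (by simp)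
  have k4 := eq_zero_of_X_pow_dvd_form hk 4 (by simp) (by simp)
  rw [transv_ten_four_form] at hm
  have hm' := eq_zero_of_X_pow_dvd_form hm
  simp only [k2, k3, k4] at hm'
  rw [transv_ten_ten_form, C_eq_zero] at hj2
  have key : a 10 = 0 → a 9 = 0 → a 8 = 0 → a 7 = 0 → X 0 ^ 6 ∣ form 10 a := by
    intro h10 h9 h8 h7
    simp only [quarticCoeff, h10, h9, h8, h7] at k2 k4
    have h6 : a 6 = 0 := by
      simpa using k4
    simp only [h6] at k2
    have h5 : a 5 = 0 := by
      simpa using k2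
    refine X_pow_dvd_form fun i hi hi' => ?_
    have : 5 ≤ i := by omega
    interval_cases i <;> assumption
  obtain h0 | h1 := hdeg
  · have h1 : quarticCoeff a 1 ≠ 0 := hne.resolve_left (fun h => h h0)
    have h : ∀ i, 3 ≤ i → i ≤ 6 → a (i + 3) = 0 := by
      intro i hi hi'
      have := hm' i hi' (by omega)
      simpa [h0, h1] using this
    have h6 := h 3 (by simp) (by simp)
    have h7 := h 4 (by simp) (by simp)
    have h8 := h 5 (by simp) (by simp)
    have h9 := h 6 (by simp) (by simp)
    norm_num at h6 h7 h8 h9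
    simp only [quarticCoeff, h6, h7, h8, h9] at k2 h1
    simp only [h6, h7, h8, h9] at hj2
    have h5 : a 5 = 0 := by
      have : a 5 ^ 2 = 0 := by linear_combination (1 / 70) * k2 - (1 / 420) * hj2
      simpa using this
    simp [h5] at h1
  · have h0 : quarticCoeff a 0 ≠ 0 := hne.resolve_right (fun h => h h1)
    have h : ∀ i, 3 ≤ i → i ≤ 6 → a (i + 4) = 0 := by
      intro i hi hi'
      have := hm' i hi' (by omega)
      simpa [h0, h1] using this
    exact key (h 6 (by simp) (by simp)) (h 5 (by simp) (by simp)) (h 4 (by simp) (by simp))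
      (h 3 (by simp) (by simp))

/-- The covariants `(f, f)₁₀`, `(f, f)₈` and `(f, (f, f)₈)₄` of `f` satisfy the nullcone
conditions at the linear form `ℓ`. -/
structure NullconeAt (ℓ f : MvPolynomial (Fin 2) ℂ) : Prop where
  transv_ten : transv 10 10 10 f f = 0
  transv_eight_ne : transv 10 10 8 f f ≠ 0
  pow_three_dvd : ℓ ^ 3 ∣ transv 10 10 8 f f
  pow_four_dvd : ℓ ^ 4 ∣ transv 10 4 4 f (transv 10 10 8 f f)

theorem NullconeAt.linSubst {a b c d : ℂ} (h : a * d - b * c = 1)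
    {ℓ f : MvPolynomial (Fin 2) ℂ} (hf : NullconeAt ℓ f) :
    NullconeAt (linSubst a b c d ℓ) (linSubst a b c d f) where
  transv_ten := by rw [transv_linSubst h, hf.transv_ten, map_zero]
  transv_eight_ne := by
    rw [transv_linSubst h]
    intro h0
    apply hf.transv_eight_ne
    have h' : d * a - (-b) * (-c) = 1 := by linear_combination h
    have := linSubst_comp_inverse h' (transv 10 10 8 f f)
    rw [neg_neg, neg_neg, h0, map_zero] at this
    exact this.symm
  pow_three_dvd := by
    rw [transv_linSubst h, ← map_pow]
    exact map_dvd _ hf.pow_three_dvd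
  pow_four_dvd := by
    rw [transv_linSubst h, transv_linSubst h, ← map_pow]
    exact map_dvd _ hf.pow_four_dvd

theorem eval_one_form_four {κ : ℕ → ℂ} (h : X 0 ^ 3 ∣ form 4 κ) (t : ℂ) :
    eval ![1, t] (form 4 κ) = κ 0 + 4 * κ 1 * t := by
  have k2 := eq_zero_of_X_pow_dvd_form h 2 (by simp) (by simp)
  have k3 := eq_zero_of_X_pow_dvd_form h 3 (by simp) (by simp)
  have k4 := eq_zero_of_X_pow_dvd_form h 4 (by simp) (by simp)
  simp [form, Finset.sum_range_succ, k2, k3, k4]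

theorem NullconeAt.X_pow_six_dvd_form {a : ℕ → ℂ} (h : NullconeAt (X 0) (form 10 a))
    (hdeg : quarticCoeff a 0 = 0 ∨ quarticCoeff a 1 = 0) : X 0 ^ 6 ∣ form 10 a := by
  obtain ⟨hj2, hne, hk, hm⟩ := h
  rw [transv_ten_eight_form] at hne hk hm
  refine X_pow_six_dvd_of_quarticCoeff ?_ hdeg hj2 hk hm
  by_contra! h01
  refine hne (Finset.sum_eq_zero fun i hi => ?_)
  have hi' := Finset.mem_range.1 hi
  have hi0 : quarticCoeff a i = 0 := by
    obtain h2 | h2 := lt_or_ge i 2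
    · interval_cases i
      exacts [h01.1, h01.2]
    · exact eq_zero_of_X_pow_dvd_form hk i (by omega) (by omega)
  rw [hi0, mul_zero, C_0, zero_mul, zero_mul]

theorem NullconeAt.X_pow_six_dvd {f : MvPolynomial (Fin 2) ℂ} (hf : f.IsHomogeneous 10)
    (h : NullconeAt (X 0) f) : X 0 ^ 6 ∣ f := by
  obtain ⟨a, rfl⟩ := exists_eq_form hf
  by_cases h1 : quarticCoeff a 1 = 0
  · exact h.X_pow_six_dvd_form (.inr h1)
  set c : ℂ := quarticCoeff a 0 / (4 * quarticCoeff a 1) with hc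
  have hdet : ∀ t : ℂ, (1 : ℂ) * 1 - 0 * t = 1 := by intro t; ring
  have hX : ∀ t : ℂ, BinaryForm.linSubst 1 0 t 1 (X 0) = X 0 := by
    intro t
    simp [BinaryForm.linSubst]
  obtain ⟨b, hb⟩ := exists_eq_form (isHomogeneous_linSubst 1 0 (-c) 1 hf)
  have hg := h.linSubst (hdet (-c))
  have hk := transv_linSubst (hdet (-c)) 10 10 8 (form 10 a) (form 10 a)
  have hka := h.pow_three_dvd
  have hkb := hg.pow_three_dvd
  rw [hX, hb] at hg hkb
  rw [hb, transv_ten_eight_form, transv_ten_eight_form] at hk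
  rw [transv_ten_eight_form] at hka hkb
  have hb0 : quarticCoeff b 0 = 0 := by
    have hev : ∀ p, eval ![1, 0] (BinaryForm.linSubst 1 0 (-c) 1 p) = eval ![1, -c] p := by
      intro p
      induction p using MvPolynomial.induction_on with
      | C r => simp [BinaryForm.linSubst]
      | add p q hp hq => simp only [map_add, hp, hq]
      | mul_X p i hp =>
        rw [map_mul, map_mul, map_mul, hp]
        fin_cases i <;> simp [BinaryForm.linSubst]
    have hev := hev (form 4 (quarticCoeff a))
    rw [← hk, eval_one_form_four hkb, eval_one_form_four hka, hc] at hev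
    field_simp at hev
    simpa using hev
  have hdvd := map_dvd (BinaryForm.linSubst 1 0 c 1) (hg.X_pow_six_dvd_form (.inl hb0))
  have hinv := linSubst_comp_inverse (hdet c) (form 10 a)
  rw [neg_zero] at hinv
  rwa [← hb, hinv, map_pow, hX] at hdvd

theorem exists_det_eq_one {a b : ℂ} (h : a ≠ 0 ∨ b ≠ 0) : ∃ c d : ℂ, a * d - b * c = 1 := by
  obtain h | h := h
  · exact ⟨0, a⁻¹, by simp [h]⟩
  · exact ⟨-b⁻¹, 0, by simp [h]⟩

end BinaryForm

/-- Let `f ∈ V₁₀`, `j₂ = (f,f)₁₀`, `k = (f,f)₈ ∈ V₄`, `m = (f,k)₄ ∈ V₆`. If `j₂ = 0`,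
`k ≠ 0`, and there is a nonzero linear form `ℓ` with `ℓ³ ∣ k` and `ℓ⁴ ∣ m` (i.e.
`(k,m)` lies in the nullcone of `V₄ ⊕ V₆`), then `f` has a root of multiplicity at
least 6. -/
theorem k_nonzero_case (f : MvPolynomial (Fin 2) ℂ) (hf : f.IsHomogeneous 10)
    (hj2 : transv 10 10 10 f f = 0)
    (hk : transv 10 10 8 f f ≠ 0)
    (hnull : ∃ a b : ℂ, (a ≠ 0 ∨ b ≠ 0) ∧
      (C a * X 0 + C b * X 1) ^ 3 ∣ transv 10 10 8 f f ∧
      (C a * X 0 + C b * X 1) ^ 4 ∣ transv 10 4 4 f (transv 10 10 8 f f)) :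
    HasRootOfMult 6 f := by
  obtain ⟨a, b, hab, hk3, hm4⟩ := hnull
  obtain ⟨c, d, hdet⟩ := BinaryForm.exists_det_eq_one hab
  have hdet' : d * a - (-b) * (-c) = 1 := by linear_combination hdet
  have hX : BinaryForm.linSubst a b c d (X 0) = C a * X 0 + C b * X 1 := by
    simp [BinaryForm.linSubst]
  have hℓ : BinaryForm.linSubst d (-b) (-c) a (C a * X 0 + C b * X 1) = X 0 := by
    have := BinaryForm.linSubst_comp_inverse hdet' (X 0)
    rwa [neg_neg, neg_neg, hX] at this
  have hg := BinaryForm.NullconeAt.linSubst hdet' ⟨hj2, hk, hk3, hm4⟩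
  rw [hℓ] at hg
  have hdvd := map_dvd (BinaryForm.linSubst a b c d)
    (hg.X_pow_six_dvd (BinaryForm.isHomogeneous_linSubst _ _ _ _ hf))
  rw [BinaryForm.linSubst_comp_inverse hdet, map_pow, hX] at hdvd
  exact ⟨a, b, hab, hdvd⟩
end
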